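/- arXiv:1607.00362 — 3 statements merged into one kernel-verified Lean document; each statement's English description precedes it below -/
import Mathlib

section
/- Exactness for polynomial observables (Theorem, spectrogram expansion, part 3): Let d ≥ 1, ε > 0, N ≥ 1, let ψ : ℝ^d → ℂ be a Schwartz function, and let a : ℝ^{2d} → ℂ be a polynomial of total degree strictly less than 2N. Then ∫_{ℝ^{2d}} a(z) W_ψ(z) dz = ∫_{ℝ^{2d}} a(z) μ_ψ^N(z) dz. -/
open MeasureTheory Finset

noncomputable section

/-- Phase space `ℝ^d × ℝ^d`. -/
abbrev PS (d : ℕ) := (Fin d → ℝ) × (Fin d → ℝ)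

/-- The Laplacian on phase space `ℝ^{2d}`. -/
def phaseLap {d : ℕ} {F : Type*} [NormedAddCommGroup F] [NormedSpace ℝ F]
    (f : PS d → F) : PS d → F := fun z =>
  (∑ i, iteratedDeriv 2 (fun t => f (Function.update z.1 i t, z.2)) (z.1 i)) +
  (∑ i, iteratedDeriv 2 (fun t => f (z.1, Function.update z.2 i t)) (z.2 i))

/-- The ε-scaled Wigner function of `ψ`. -/
def wigner {d : ℕ} (ε : ℝ) (ψ : (Fin d → ℝ) → ℂ) : PS d → ℂ := fun z =>
  (((2 * Real.pi * ε) ^ d : ℝ))⁻¹ •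
    ∫ y : Fin d → ℝ,
      Complex.exp (Complex.I * (∑ i, z.2 i * y i) / ε) *
        ψ (fun i => z.1 i - y i / 2) * (starRingEnd ℂ) (ψ (fun i => z.1 i + y i / 2))

/-- The phase-space Gaussian `W_0(z) = (πε)^{−d} e^{−|z|²/ε}`. -/
def gaussW0 {d : ℕ} (ε : ℝ) : PS d → ℝ := fun z =>
  (((Real.pi * ε) ^ d : ℝ))⁻¹ * Real.exp (-(∑ i, (z.1 i ^ 2 + z.2 i ^ 2)) / ε)

/-- The Husimi function `S_0 ψ = W_ψ * W_0`. -/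
def husimi {d : ℕ} (ε : ℝ) (ψ : (Fin d → ℝ) → ℂ) : PS d → ℂ :=
  fun z => ∫ w : PS d, wigner ε ψ w * ((gaussW0 ε (z - w) : ℝ) : ℂ)

/-- The spectrogram density `μ_ψ^N = Σ_{m<N} (1/m!) (−ε/4)^m Δ^m (S_0 ψ)`. -/
def specDensity {d : ℕ} (ε : ℝ) (ψ : (Fin d → ℝ) → ℂ) (N : ℕ) : PS d → ℂ := fun z =>
  ∑ m ∈ Finset.range N,
    ((Nat.factorial m : ℂ))⁻¹ * (-(ε : ℂ) / 4) ^ m * (phaseLap^[m] (husimi ε ψ)) z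

/-- Evaluation of a polynomial in the `2d` phase-space variables at `z ∈ ℝ^{2d}`. -/
def polyEval {d : ℕ} (a : MvPolynomial (Fin d ⊕ Fin d) ℂ) (z : PS d) : ℂ :=
  MvPolynomial.eval (Sum.elim (fun i => ((z.1 i : ℝ) : ℂ)) (fun i => ((z.2 i : ℝ) : ℂ))) a

set_option linter.unusedSectionVars false
set_option linter.unusedSimpArgs false

section AlgebraPart
open MvPolynomial

variable {σ : Type*}

/-- All coefficients of degree at least `n` vanish. -/
def DegLT (n : ℕ) (b : MvPolynomial σ ℂ) : Prop := ∀ m : σ →₀ ℕ, n ≤ m.degree → coeff m b = 0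

lemma degLT_pderiv {n : ℕ} {b : MvPolynomial σ ℂ} (h : DegLT (n + 1) b) (j : σ) :
    DegLT n (pderiv j b) := by
  classical
  intro m hm
  rw [coeff_pderiv, h, zero_mul]
  simp only [map_add, Finsupp.degree_single]
  omega

lemma degLT_zero {b : MvPolynomial σ ℂ} (h : DegLT 0 b) : b = 0 := by
  ext m
  simpa using h m (Nat.zero_le _)

lemma degLT_of_totalDegree {n : ℕ} {b : MvPolynomial σ ℂ} (h : b.totalDegree < n) :
    DegLT n b := by
  intro m hm
  apply coeff_eq_zero_of_totalDegree_lt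
  have : m.degree = ∑ i ∈ m.support, m i := rfl
  omega

lemma pderiv_pderiv_comm (i j : σ) (b : MvPolynomial σ ℂ) :
    pderiv i (pderiv j b) = pderiv j (pderiv i b) := by
  classical
  ext m
  simp only [coeff_pderiv]
  by_cases h : i = j
  · subst h; rfl
  · have h1 : (Finsupp.single i 1 : σ →₀ ℕ) j = 0 := by simp [Finsupp.single_apply, h]
    have h2 : (Finsupp.single j 1 : σ →₀ ℕ) i = 0 := by
      simp [Finsupp.single_apply, Ne.symm h]
    simp only [Finsupp.add_apply, h1, h2, add_zero]
    rw [add_right_comm]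
    ring

variable [Fintype σ]

/-- The Laplacian on polynomials. -/
def polyLap : Module.End ℂ (MvPolynomial σ ℂ) :=
  ∑ j : σ, (pderiv j).toLinearMap ∘ₗ (pderiv j).toLinearMap

lemma polyLap_apply (b : MvPolynomial σ ℂ) :
    polyLap b = ∑ j : σ, pderiv j (pderiv j b) := by
  simp [polyLap, LinearMap.sum_apply]

lemma degLT_polyLap {n : ℕ} {b : MvPolynomial σ ℂ} (h : DegLT (n + 2) b) :
    DegLT n (polyLap b) := by
  intro m hm
  rw [polyLap_apply, coeff_sum]
  exact Finset.sum_eq_zero fun j _ => degLT_pderiv (degLT_pderiv h j) j m hm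

lemma degLT_polyLap_pow {n k : ℕ} {b : MvPolynomial σ ℂ} (h : DegLT (n + 2 * k) b) :
    DegLT n ((polyLap ^ k) b) := by
  induction k generalizing n with
  | zero => simpa using h
  | succ k ih =>
    rw [pow_succ', Module.End.mul_apply]
    apply degLT_polyLap
    apply ih
    convert h using 1
    ring

lemma polyLap_pderiv (j : σ) (b : MvPolynomial σ ℂ) :
    polyLap (pderiv j b) = pderiv j (polyLap b) := by
  simp only [polyLap_apply, map_sum]
  refine Finset.sum_congr rfl fun i _ => ?_
  rw [pderiv_pderiv_comm i j, pderiv_pderiv_comm i j]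

lemma polyLap_X_mul (j : σ) (b : MvPolynomial σ ℂ) :
    polyLap (X j * b) = X j * polyLap b + 2 * pderiv j b := by
  classical
  have h : ∀ i, pderiv i (pderiv i (X j * b)) =
      X j * pderiv i (pderiv i b) + (if i = j then 2 * pderiv j b else 0) := by
    intro i
    by_cases hij : i = j
    · subst hij
      simp [pderiv_mul]
      ring
    · simp [pderiv_mul, pderiv_X_of_ne (Ne.symm hij), hij]
  simp only [polyLap_apply, h, Finset.sum_add_distrib, Finset.mul_sum, Finset.sum_ite_eq',
    Finset.mem_univ, if_true]

lemma polyLap_pow_X_mul (j : σ) (m : ℕ) (b : MvPolynomial σ ℂ) :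
    (polyLap ^ (m + 1)) (X j * b) =
      X j * (polyLap ^ (m + 1)) b + (2 * (m + 1 : ℂ)) • pderiv j ((polyLap ^ m) b) := by
  induction m with
  | zero => simp [polyLap_X_mul, smul_eq_C_mul, map_ofNat]
  | succ m ih =>
    rw [pow_succ', Module.End.mul_apply, ih, map_add, polyLap_X_mul, map_smul, polyLap_pderiv,
      ← Module.End.mul_apply, ← Module.End.mul_apply, ← pow_succ', ← pow_succ', add_assoc]
    congr 1
    simp only [smul_eq_C_mul, map_mul, map_add, map_ofNat, map_one]
    push_cast
    simp only [map_add, map_natCast, map_one]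
    ring

/-- The key algebraic identity. -/
lemma gauss_sum_identity (ε : ℂ) (T : MvPolynomial σ ℂ →ₗ[ℂ] ℂ)
    (hT1 : T 1 = 1) (hT : ∀ j b, T (X j * b) = ε / 2 * T (pderiv j b))
    (N : ℕ) (hN : 1 ≤ N) (b : MvPolynomial σ ℂ) (hb : b.totalDegree < 2 * N) :
    ∑ m ∈ Finset.range N, ((Nat.factorial m : ℂ))⁻¹ * (-ε / 4) ^ m * T ((polyLap ^ m) b)
      = constantCoeff b := by
  classical
  -- the statement for X_j * b
  have hX : ∀ j (b : MvPolynomial σ ℂ), DegLT (2 * N - 1) b → ∀ K, 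
      ∑ m ∈ Finset.range (K + 1), ((Nat.factorial m : ℂ))⁻¹ * (-ε / 4) ^ m *
        T ((polyLap ^ m) (X j * b)) =
      ε / 2 * (((Nat.factorial K : ℂ))⁻¹ * (-ε / 4) ^ K * T (pderiv j ((polyLap ^ K) b))) := by
    intro j b _ K
    induction K with
    | zero => simp [hT]
    | succ K ih =>
      rw [Finset.sum_range_succ, ih, polyLap_pow_X_mul, map_add, hT, map_smul, smul_eq_mul,
        Nat.factorial_succ]
      have h1 : (Nat.factorial K : ℂ) ≠ 0 := by exact_mod_cast Nat.factorial_ne_zero K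
      have h2 : (K : ℂ) + 1 ≠ 0 := by exact_mod_cast Nat.succ_ne_zero K
      push_cast
      field_simp
      ring
  have hX0 : ∀ j (b : MvPolynomial σ ℂ), DegLT (2 * N - 1) b → 
      ∑ m ∈ Finset.range N, ((Nat.factorial m : ℂ))⁻¹ * (-ε / 4) ^ m *
        T ((polyLap ^ m) (X j * b)) = 0 := by
    intro j b hb
    obtain ⟨K, rfl⟩ : ∃ K, N = K + 1 := ⟨N - 1, by omega⟩
    rw [hX j b hb]
    have : DegLT 1 ((polyLap ^ K) b) := by
      apply degLT_polyLap_pow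
      convert hb using 1
      omega
    rw [degLT_zero (degLT_pderiv this j)]
    simp
  have hmon : ∀ (s : σ →₀ ℕ) (c : ℂ), s.degree < 2 * N →
      ∑ m ∈ Finset.range N, ((Nat.factorial m : ℂ))⁻¹ * (-ε / 4) ^ m *
        T ((polyLap ^ m) (monomial s c)) = constantCoeff (monomial s c) := by
    intro s c hs
    by_cases h0 : s = 0
    · subst h0
      obtain ⟨K, rfl⟩ : ∃ K, N = K + 1 := ⟨N - 1, by omega⟩
      rw [Finset.sum_range_succ']
      have hz : ∀ m, (polyLap ^ (m + 1)) (monomial (0 : σ →₀ ℕ) c) = 0 := by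
        intro m
        rw [pow_succ, Module.End.mul_apply]
        have : polyLap (monomial (0 : σ →₀ ℕ) c) = 0 := by
          simp [polyLap_apply, pderiv_monomial]
        rw [this, map_zero]
      simp only [hz, map_zero, mul_zero, Finset.sum_const_zero, zero_add]
      have : (monomial (0 : σ →₀ ℕ) c) = c • (1 : MvPolynomial σ ℂ) := by
        rw [smul_eq_C_mul, mul_one]; rfl
      simp [this, hT1]
    · obtain ⟨j, hj⟩ : ∃ j, s j ≠ 0 := by
        by_contra! h
        exact h0 (Finsupp.ext h)
      have hs' : s = Finsupp.single j 1 + (s - Finsupp.single j 1) := by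
        rw [add_tsub_cancel_of_le]
        rw [Finsupp.single_le_iff]
        omega
      have hd : s.degree = 1 + (s - Finsupp.single j 1).degree := by
        conv_lhs => rw [hs']
        simp
      have hm : monomial s c = X j * monomial (s - Finsupp.single j 1) c := by
        rw [X, monomial_mul, one_mul, ← hs']
      rw [hm, hX0]
      · simp
      · intro m hm
        rw [coeff_monomial, if_neg]
        rintro rfl
        omega
  conv_lhs => rw [b.as_sum]
  conv_rhs => rw [b.as_sum]
  simp only [map_sum, Finset.mul_sum]
  rw [Finset.sum_comm]
  refine Finset.sum_congr rfl fun s hs => ?_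
  rw [hmon]
  have := le_totalDegree hs
  have h2 : s.degree = ∑ i ∈ s.support, s i := rfl
  rw [Finsupp.sum] at this
  omega

/-- Translation of polynomials. -/
def polyShift (w : σ → ℂ) (a : MvPolynomial σ ℂ) : MvPolynomial σ ℂ :=
  bind₁ (fun j => X j + C (w j)) a

lemma polyShift_totalDegree (w : σ → ℂ) (a : MvPolynomial σ ℂ) :
    (polyShift w a).totalDegree ≤ a.totalDegree := by
  classical
  rw [polyShift]
  conv_lhs => rw [a.as_sum, map_sum]
  apply totalDegree_finsetSum_le
  intro s hs
  rw [bind₁_monomial]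
  refine (totalDegree_mul _ _).trans ?_
  rw [totalDegree_C, zero_add]
  refine (totalDegree_finsetProd _ _).trans ?_
  refine le_trans ?_ (le_totalDegree hs)
  rw [Finsupp.sum]
  refine Finset.sum_le_sum fun i _ => ?_
  refine (totalDegree_pow _ _).trans ?_
  have : (X i + C (w i) : MvPolynomial σ ℂ).totalDegree ≤ 1 := by
    refine (totalDegree_add _ _).trans ?_
    simp
  nlinarith

lemma polyShift_eval (w u : σ → ℂ) (a : MvPolynomial σ ℂ) :
    eval u (polyShift w a) = eval (fun j => u j + w j) a := by
  rw [polyShift, ← coe_aeval_eq_eval, ← coe_aeval_eq_eval]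
  change aeval u (bind₁ _ a) = _
  rw [aeval_bind₁]
  simp

lemma polyShift_constantCoeff (w : σ → ℂ) (a : MvPolynomial σ ℂ) :
    constantCoeff (polyShift w a) = eval w a := by
  have := polyShift_eval w 0 a
  rw [eval_zero] at this
  simpa using this

end AlgebraPart

section GaussPart
open MvPolynomial

variable {d : ℕ}

/-- Phase-space coordinates. -/
def crd (z : PS d) : Fin d ⊕ Fin d → ℝ := Sum.elim z.1 z.2

/-- Phase-space coordinate vectors. -/
def bvec (j : Fin d ⊕ Fin d) : PS d :=
  Sum.elim (fun i => (Pi.single i 1, 0)) (fun i => (0, Pi.single i 1)) j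

lemma polyEval_eq (a : MvPolynomial (Fin d ⊕ Fin d) ℂ) (z : PS d) :
    polyEval a z = eval (fun j => ((crd z j : ℝ) : ℂ)) a := by
  unfold polyEval
  congr 2
  funext j
  cases j <;> rfl

lemma crd_add (z w : PS d) (j) : crd (z + w) j = crd z j + crd w j := by
  cases j <;> rfl

lemma crd_smul_bvec (t : ℝ) (j k : Fin d ⊕ Fin d) :
    crd (t • (bvec j : PS d)) k = if k = j then t else 0 := by
  classical
  cases j <;> cases k <;> simp [crd, bvec, Pi.single_apply]

lemma abs_crd_le (z : PS d) (j) : |crd z j| ≤ ‖z‖ := by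
  cases j with
  | inl i => exact (norm_le_pi_norm z.1 i).trans (norm_fst_le z)
  | inr i => exact (norm_le_pi_norm z.2 i).trans (norm_snd_le z)

lemma continuous_crd (j : Fin d ⊕ Fin d) : Continuous (fun z : PS d => crd z j) := by
  cases j with
  | inl i => exact (continuous_apply i).comp continuous_fst
  | inr i => exact (continuous_apply i).comp continuous_snd

lemma polyEval_add (a b : MvPolynomial (Fin d ⊕ Fin d) ℂ) (z : PS d) :
    polyEval (a + b) z = polyEval a z + polyEval b z := by simp [polyEval]

lemma polyEval_mul (a b : MvPolynomial (Fin d ⊕ Fin d) ℂ) (z : PS d) :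
    polyEval (a * b) z = polyEval a z * polyEval b z := by simp [polyEval]

lemma polyEval_C (c : ℂ) (z : PS d) : polyEval (C c) z = c := by simp [polyEval]

lemma polyEval_X (j) (z : PS d) : polyEval (X j) z = (crd z j : ℂ) := by simp [polyEval_eq]

lemma continuous_polyEval (a : MvPolynomial (Fin d ⊕ Fin d) ℂ) :
    Continuous (fun z : PS d => polyEval a z) := by
  induction a using MvPolynomial.induction_on with
  | C c => simpa only [polyEval_C] using continuous_const
  | add p q hp hq => simp only [polyEval_add]; exact hp.add hq
  | mul_X p j hp =>
    simp only [polyEval_mul, polyEval_X]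
    exact hp.mul (Complex.continuous_ofReal.comp (continuous_crd j))

lemma polyEval_bound (a : MvPolynomial (Fin d ⊕ Fin d) ℂ) :
    ∃ (c : ℝ) (n : ℕ), 0 ≤ c ∧ ∀ z : PS d, ‖polyEval a z‖ ≤ c * (1 + ‖z‖) ^ n := by
  induction a using MvPolynomial.induction_on with
  | C c => exact ⟨‖c‖, 0, norm_nonneg _, fun z => by simp [polyEval_C]⟩
  | add p q hp hq =>
    obtain ⟨c, n, hc, h⟩ := hp
    obtain ⟨c', n', hc', h'⟩ := hq
    refine ⟨c + c', n + n', by positivity, fun z => ?_⟩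
    rw [polyEval_add]
    have h1 : (1 : ℝ) ≤ 1 + ‖z‖ := by linarith [norm_nonneg z]
    have e1 : (1 + ‖z‖) ^ n ≤ (1 + ‖z‖) ^ (n + n') := pow_le_pow_right₀ h1 (by omega)
    have e2 : (1 + ‖z‖) ^ n' ≤ (1 + ‖z‖) ^ (n + n') := pow_le_pow_right₀ h1 (by omega)
    calc _ ≤ _ := norm_add_le _ _
      _ ≤ c * (1 + ‖z‖) ^ n + c' * (1 + ‖z‖) ^ n' := add_le_add (h z) (h' z)
      _ ≤ c * (1 + ‖z‖) ^ (n + n') + c' * (1 + ‖z‖) ^ (n + n') := by gcongr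
      _ = _ := by ring
  | mul_X p j hp =>
    obtain ⟨c, n, hc, h⟩ := hp
    refine ⟨c, n + 1, hc, fun z => ?_⟩
    rw [polyEval_mul, polyEval_X, norm_mul, Complex.norm_real, Real.norm_eq_abs, pow_succ,
      ← mul_assoc]
    have := abs_crd_le z j
    gcongr
    · exact h z
    · linarith

lemma gaussW0_eq (ε : ℝ) (z : PS d) :
    gaussW0 ε z = (((Real.pi * ε) ^ d : ℝ))⁻¹ * Real.exp (-(∑ j, crd z j ^ 2) / ε) := by
  simp [gaussW0, Fintype.sum_sum_type, crd, Finset.sum_add_distrib]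

lemma norm_sq_le_sum_crd (z : PS d) : ‖z‖ ^ 2 ≤ ∑ j, crd z j ^ 2 := by
  have hs : 0 ≤ ∑ j, crd z j ^ 2 := Finset.sum_nonneg fun j _ => sq_nonneg _
  have key : ∀ j, |crd z j| ≤ Real.sqrt (∑ j, crd z j ^ 2) := by
    intro j
    apply Real.abs_le_sqrt
    exact Finset.single_le_sum (f := fun j => crd z j ^ 2) (fun j _ => sq_nonneg _)
      (Finset.mem_univ j)
  have : ‖z‖ ≤ Real.sqrt (∑ j, crd z j ^ 2) := by
    rw [Prod.norm_def]
    apply max_le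
    · exact (pi_norm_le_iff_of_nonneg (Real.sqrt_nonneg _)).2 fun i => key (Sum.inl i)
    · exact (pi_norm_le_iff_of_nonneg (Real.sqrt_nonneg _)).2 fun i => key (Sum.inr i)
  calc ‖z‖ ^ 2 ≤ Real.sqrt (∑ j, crd z j ^ 2) ^ 2 := by gcongr
    _ = _ := Real.sq_sqrt hs

lemma gaussW0_nonneg {ε : ℝ} (hε : 0 < ε) (z : PS d) : 0 ≤ gaussW0 ε z := by
  unfold gaussW0
  have := Real.pi_pos
  positivity

lemma gaussW0_decay {ε : ℝ} (hε : 0 < ε) (k : ℕ) :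
    ∃ c : ℝ, ∀ z : PS d, (1 + ‖z‖) ^ k * gaussW0 ε z ≤ c := by
  have hpi := Real.pi_pos
  refine ⟨(((Real.pi * ε) ^ d : ℝ))⁻¹ * (k.factorial * ε ^ k * Real.exp (2 / ε)), fun z => ?_⟩
  rw [gaussW0_eq]
  have h0 := norm_nonneg z
  have h1 : (1 + ‖z‖) ^ k ≤ (2 + ‖z‖ ^ 2) ^ k := by
    apply pow_le_pow_left₀ (by positivity)
    nlinarith [sq_nonneg (‖z‖ - 1)]
  have h2 : (2 + ‖z‖ ^ 2) ^ k ≤ k.factorial * ε ^ k * Real.exp ((2 + ‖z‖ ^ 2) / ε) := by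
    have := Real.pow_div_factorial_le_exp ((2 + ‖z‖ ^ 2) / ε) (by positivity) k
    rw [div_pow, div_div, div_le_iff₀ (by positivity)] at this
    linarith
  have h3 : Real.exp (-(∑ j, crd z j ^ 2) / ε) ≤ Real.exp (-(‖z‖ ^ 2) / ε) := by
    have := norm_sq_le_sum_crd z
    gcongr
  have h4 : Real.exp ((2 + ‖z‖ ^ 2) / ε) * Real.exp (-(‖z‖ ^ 2) / ε) = Real.exp (2 / ε) := by
    rw [← Real.exp_add]; congr 1; ring
  calc (1 + ‖z‖) ^ k * ((((Real.pi * ε) ^ d : ℝ))⁻¹ * Real.exp (-(∑ j, crd z j ^ 2) / ε))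
      ≤ (k.factorial * ε ^ k * Real.exp ((2 + ‖z‖ ^ 2) / ε)) *
        ((((Real.pi * ε) ^ d : ℝ))⁻¹ * Real.exp (-(‖z‖ ^ 2) / ε)) := by
        gcongr
        exact h1.trans h2
    _ = (((Real.pi * ε) ^ d : ℝ))⁻¹ * (k.factorial * ε ^ k *
        (Real.exp ((2 + ‖z‖ ^ 2) / ε) * Real.exp (-(‖z‖ ^ 2) / ε))) := by ring
    _ ≤ _ := by rw [h4]

lemma continuous_gaussW0 (ε : ℝ) : Continuous (fun z : PS d => gaussW0 ε z) := by
  unfold gaussW0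
  fun_prop

/-- Polynomial times Gaussian. -/
def gP (ε : ℝ) (b : MvPolynomial (Fin d ⊕ Fin d) ℂ) (u : PS d) : ℂ :=
  polyEval b u * ((gaussW0 ε u : ℝ) : ℂ)

lemma continuous_gP (ε : ℝ) (b : MvPolynomial (Fin d ⊕ Fin d) ℂ) : Continuous (gP ε b) :=
  (continuous_polyEval b).mul (Complex.continuous_ofReal.comp (continuous_gaussW0 ε))

lemma gP_decay {ε : ℝ} (hε : 0 < ε) (b : MvPolynomial (Fin d ⊕ Fin d) ℂ) (k : ℕ) :
    ∃ c : ℝ, ∀ z : PS d, (1 + ‖z‖) ^ k * ‖gP ε b z‖ ≤ c := by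
  obtain ⟨c, n, hc, h⟩ := polyEval_bound b
  obtain ⟨c', h'⟩ := gaussW0_decay (d := d) hε (k + n)
  refine ⟨c * c', fun z => ?_⟩
  rw [gP, norm_mul, Complex.norm_real, Real.norm_of_nonneg (gaussW0_nonneg hε z)]
  have := gaussW0_nonneg hε z
  calc (1 + ‖z‖) ^ k * (‖polyEval b z‖ * gaussW0 ε z)
      ≤ (1 + ‖z‖) ^ k * ((c * (1 + ‖z‖) ^ n) * gaussW0 ε z) := by gcongr; exact h z
    _ = c * ((1 + ‖z‖) ^ (k + n) * gaussW0 ε z) := by ring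
    _ ≤ c * c' := by gcongr; exact h' z

lemma integrable_of_decay {E : Type*} [NormedAddCommGroup E] [NormedSpace ℝ E]
    [FiniteDimensional ℝ E] [MeasurableSpace E] [BorelSpace E] (μ : Measure E)
    [μ.IsAddHaarMeasure] {f : E → ℂ} (hf : AEStronglyMeasurable f μ)
    (h : ∀ k : ℕ, ∃ c : ℝ, ∀ z, (1 + ‖z‖) ^ k * ‖f z‖ ≤ c) (k : ℕ) :
    Integrable (fun z => (1 + ‖z‖) ^ k * ‖f z‖) μ := by
  obtain ⟨c, hc⟩ := h (k + (Module.finrank ℝ E + 1))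
  have hi := (integrable_one_add_norm (E := E) (μ := μ)
    (r := ((Module.finrank ℝ E + 1 : ℕ) : ℝ)) (by push_cast; linarith)).const_mul c
  refine hi.mono' ?_ ?_
  · refine AEStronglyMeasurable.mul ?_ hf.norm
    exact (Continuous.aestronglyMeasurable (by fun_prop))
  · refine Filter.Eventually.of_forall fun z => ?_
    have h1 : 0 < 1 + ‖z‖ := by linarith [norm_nonneg z]
    rw [Real.norm_of_nonneg (by positivity), Real.rpow_neg h1.le, Real.rpow_natCast,
      ← div_eq_mul_inv, le_div_iff₀ (by positivity)]
    calc _ = (1 + ‖z‖) ^ (k + (Module.finrank ℝ E + 1)) * ‖f z‖ := by ring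
      _ ≤ c := hc z

lemma volPS_haar : (volume : Measure (PS d)).IsAddHaarMeasure :=
  Measure.prod.instIsAddHaarMeasure (volume : Measure (Fin d → ℝ)) (volume : Measure (Fin d → ℝ))

lemma gP_integrable {ε : ℝ} (hε : 0 < ε) (b : MvPolynomial (Fin d ⊕ Fin d) ℂ) (k : ℕ) :
    Integrable (fun z : PS d => (1 + ‖z‖) ^ k * ‖gP ε b z‖) :=
  haveI := volPS_haar (d := d)
  integrable_of_decay _ (continuous_gP ε b).aestronglyMeasurable (gP_decay hε b) k

lemma gP_integrable' {ε : ℝ} (hε : 0 < ε) (b : MvPolynomial (Fin d ⊕ Fin d) ℂ) :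
    Integrable (gP ε b : PS d → ℂ) := by
  rw [← integrable_norm_iff (continuous_gP ε b).aestronglyMeasurable]
  simpa using gP_integrable hε b 0

/-- The derivative of polynomial times Gaussian, on the polynomial side. -/
def gD (ε : ℝ) (j : Fin d ⊕ Fin d) (b : MvPolynomial (Fin d ⊕ Fin d) ℂ) :
    MvPolynomial (Fin d ⊕ Fin d) ℂ := pderiv j b - C (2 / (ε : ℂ)) * (X j * b)

lemma hasDerivAt_crd (z : PS d) (j k : Fin d ⊕ Fin d) (t : ℝ) :
    HasDerivAt (fun t : ℝ => crd (z + t • bvec j) k) (if k = j then 1 else 0) t := by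
  simp only [crd_add, crd_smul_bvec]
  split_ifs
  · exact (hasDerivAt_id t).const_add _
  · exact hasDerivAt_const t _

lemma hasDerivAt_polyEval (b : MvPolynomial (Fin d ⊕ Fin d) ℂ) (z : PS d) (j) (t : ℝ) :
    HasDerivAt (fun t : ℝ => polyEval b (z + t • bvec j))
      (polyEval (pderiv j b) (z + t • bvec j)) t := by
  classical
  induction b using MvPolynomial.induction_on with
  | C c => simpa [polyEval] using hasDerivAt_const t c
  | add p q hp hq => simp only [map_add, polyEval_add]; exact hp.add hq
  | mul_X p k hp =>
    have := hp.mul (hasDerivAt_crd z j k t).ofReal_comp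
    simp only [polyEval_mul, polyEval_X, pderiv_mul, polyEval_add]
    refine HasDerivAt.congr_deriv this ?_
    rw [pderiv_X]
    by_cases h : k = j
    · subst h; simp [polyEval]
    · simp [h, polyEval, Ne.symm h]

lemma hasDerivAt_gaussW0 (ε : ℝ) (z : PS d) (j) (t : ℝ) :
    HasDerivAt (fun t : ℝ => gaussW0 ε (z + t • bvec j))
      (-(2 / ε) * crd (z + t • bvec j) j * gaussW0 ε (z + t • bvec j)) t := by
  simp only [gaussW0_eq]
  have h1 : HasDerivAt (fun t : ℝ => ∑ k, crd (z + t • bvec j) k ^ 2)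
      (∑ k, 2 * crd (z + t • bvec j) k * (if k = j then 1 else 0)) t := by
    apply HasDerivAt.fun_sum
    intro k _
    exact ((hasDerivAt_crd z j k t).pow 2).congr_deriv (by simp)
  have h2 := ((h1.neg.div_const ε).exp).const_mul ((((Real.pi * ε) ^ d : ℝ))⁻¹)
  refine HasDerivAt.congr_deriv h2 ?_
  simp
  ring

lemma hasDerivAt_gP (ε : ℝ) (b : MvPolynomial (Fin d ⊕ Fin d) ℂ) (z : PS d) (j) (t : ℝ) :
    HasDerivAt (fun t : ℝ => gP ε b (z + t • bvec j)) (gP ε (gD ε j b) (z + t • bvec j)) t := by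
  have := (hasDerivAt_polyEval b z j t).mul (hasDerivAt_gaussW0 ε z j t).ofReal_comp
  unfold gP
  refine HasDerivAt.congr_deriv this ?_
  simp only [gD, sub_eq_add_neg, polyEval_add, polyEval_mul, polyEval_X, polyEval_C,
    ← neg_mul, ← C_neg]
  push_cast
  ring

lemma integral_gP_gD {ε : ℝ} (hε : 0 < ε) (j) (b : MvPolynomial (Fin d ⊕ Fin d) ℂ) :
    ∫ u : PS d, gP ε (gD ε j b) u = 0 := by
  have := volPS_haar (d := d)
  have := integral_bilinear_hasLineDerivAt_right_eq_neg_left_of_integrable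
    (μ := (volume : Measure (PS d))) (f := fun _ => (1 : ℂ)) (f' := fun _ => 0)
    (g := gP ε b) (g' := gP ε (gD ε j b)) (v := bvec j) (B := ContinuousLinearMap.mul ℝ ℂ)
    (by simp) (by simpa using gP_integrable' hε _) (by simpa using gP_integrable' hε b)
    (fun x _ => hasDerivAt_const _ _) (fun x _ => by
      have := hasDerivAt_gP ε b x j 0
      simpa [HasLineDerivAt] using this)
  simpa using this

lemma integral_gaussW0 {ε : ℝ} (hε : 0 < ε) : ∫ u : PS d, gaussW0 ε u = 1 := by
  have h : ∀ u : PS d, gaussW0 ε u = (((Real.pi * ε) ^ d : ℝ))⁻¹ *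
      ((∏ i, Real.exp (-(1 / ε) * u.1 i ^ 2)) * (∏ i, Real.exp (-(1 / ε) * u.2 i ^ 2))) := by
    intro u
    rw [gaussW0, ← Real.exp_sum, ← Real.exp_sum, ← Real.exp_add, ← Finset.sum_add_distrib]
    congr 2
    rw [neg_div, Finset.sum_div, ← Finset.sum_neg_distrib]
    refine Finset.sum_congr rfl fun i _ => ?_
    ring
  have hpi := Real.pi_pos
  simp only [h]
  rw [integral_const_mul, Measure.volume_eq_prod,
    integral_prod_mul (fun x : Fin d → ℝ => ∏ i, Real.exp (-(1 / ε) * x i ^ 2))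
      (fun x : Fin d → ℝ => ∏ i, Real.exp (-(1 / ε) * x i ^ 2)),
    integral_fintype_prod_volume_eq_prod (fun (_ : Fin d) (x : ℝ) => Real.exp (-(1 / ε) * x ^ 2))]
  simp only [integral_gaussian, Finset.prod_const, Finset.card_univ, Fintype.card_fin]
  rw [← mul_pow, Real.mul_self_sqrt (by positivity), ← inv_pow, ← mul_pow]
  have : (Real.pi * ε)⁻¹ * (Real.pi / (1 / ε)) = 1 := by field_simp
  rw [this, one_pow]

/-- The Gaussian moment functional. -/
def gT {ε : ℝ} (hε : 0 < ε) : MvPolynomial (Fin d ⊕ Fin d) ℂ →ₗ[ℂ] ℂ where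
  toFun b := ∫ u : PS d, gP ε b u
  map_add' a b := by
    rw [← integral_add (gP_integrable' hε a) (gP_integrable' hε b)]
    congr 1; funext u; simp [gP, polyEval_add, add_mul]
  map_smul' c b := by
    rw [RingHom.id_apply, smul_eq_mul, ← integral_const_mul]
    congr 1; funext u; simp [gP, smul_eq_C_mul, polyEval_mul, polyEval_C, mul_assoc]

lemma gT_apply {ε : ℝ} (hε : 0 < ε) (b : MvPolynomial (Fin d ⊕ Fin d) ℂ) :
    gT hε b = ∫ u : PS d, gP ε b u := rfl

lemma gT_one {ε : ℝ} (hε : 0 < ε) : gT (d := d) hε 1 = 1 := by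
  have : ∀ u : PS d, gP ε 1 u = ((gaussW0 ε u : ℝ) : ℂ) := by intro u; simp [gP, polyEval]
  rw [gT_apply]
  simp only [this]
  rw [integral_complex_ofReal]
  rw [integral_gaussW0 hε]
  simp

lemma gT_gD {ε : ℝ} (hε : 0 < ε) (j) (b : MvPolynomial (Fin d ⊕ Fin d) ℂ) :
    gT hε (gD ε j b) = 0 := integral_gP_gD hε j b

lemma gT_X_mul {ε : ℝ} (hε : 0 < ε) (j) (b : MvPolynomial (Fin d ⊕ Fin d) ℂ) :
    gT hε (X j * b) = (ε : ℂ) / 2 * gT hε (pderiv j b) := by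
  have := gT_gD hε j b
  rw [gD, ← smul_eq_C_mul, map_sub, map_smul, smul_eq_mul] at this
  have hne : (ε : ℂ) ≠ 0 := by exact_mod_cast hε.ne'
  rw [sub_eq_zero.1 this]
  field_simp

lemma gT_mul_gD {ε : ℝ} (hε : 0 < ε) (j) (a b : MvPolynomial (Fin d ⊕ Fin d) ℂ) :
    gT hε (a * gD ε j b) = - gT hε (pderiv j a * b) := by
  have h := gT_gD hε j (a * b)
  have : gD ε j (a * b) = a * gD ε j b + pderiv j a * b := by
    simp only [gD, pderiv_mul]; ring
  rw [this, map_add] at h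
  exact eq_neg_of_add_eq_zero_left h

/-- The Laplacian of polynomial times Gaussian, on the polynomial side. -/
def gLap (ε : ℝ) (b : MvPolynomial (Fin d ⊕ Fin d) ℂ) : MvPolynomial (Fin d ⊕ Fin d) ℂ :=
  ∑ j, gD ε j (gD ε j b)

lemma gT_mul_gLap {ε : ℝ} (hε : 0 < ε) (a b : MvPolynomial (Fin d ⊕ Fin d) ℂ) :
    gT hε (a * gLap ε b) = gT hε (polyLap a * b) := by
  rw [gLap, polyLap_apply, Finset.mul_sum, Finset.sum_mul, map_sum, map_sum]
  refine Finset.sum_congr rfl fun j _ => ?_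
  rw [gT_mul_gD, gT_mul_gD, neg_neg]

lemma gT_mul_gLap_iter {ε : ℝ} (hε : 0 < ε) (m : ℕ) (a : MvPolynomial (Fin d ⊕ Fin d) ℂ) :
    gT hε (a * (gLap ε)^[m] 1) = gT hε ((polyLap ^ m) a) := by
  induction m generalizing a with
  | zero => simp
  | succ m ih =>
    rw [Function.iterate_succ_apply', gT_mul_gLap, ih, pow_succ, Module.End.mul_apply]

end GaussPart

section ConvPart
open MvPolynomial

variable {d : ℕ}

/-- Convolution of `W` with polynomial times Gaussian. -/
def cv (W : PS d → ℂ) (ε : ℝ) (b : MvPolynomial (Fin d ⊕ Fin d) ℂ) (z : PS d) : ℂ :=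
  ∫ w : PS d, W w * gP ε b (z - w)

lemma husimi_eq_cv (ε : ℝ) (ψ : (Fin d → ℝ) → ℂ) : husimi ε ψ = cv (wigner ε ψ) ε 1 := by
  funext z
  simp [husimi, cv, gP, polyEval]

lemma W_integrable {W : PS d → ℂ} (hm : AEStronglyMeasurable W volume)
    (hW : ∀ k : ℕ, Integrable (fun w => (1 + ‖w‖) ^ k * ‖W w‖)) : Integrable W := by
  rw [← integrable_norm_iff hm]
  simpa using hW 0

lemma cv_hasDerivAt {W : PS d → ℂ} (hW : Integrable W) {ε : ℝ} (hε : 0 < ε)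
    (b : MvPolynomial (Fin d ⊕ Fin d) ℂ) (z : PS d) (j) (t : ℝ) :
    HasDerivAt (fun t : ℝ => cv W ε b (z + t • bvec j)) (cv W ε (gD ε j b) (z + t • bvec j)) t := by
  have meas : ∀ (c : MvPolynomial (Fin d ⊕ Fin d) ℂ) (x : PS d),
      AEStronglyMeasurable (fun w => W w * gP ε c (x - w)) volume := fun c x =>
    hW.aestronglyMeasurable.mul
      ((continuous_gP ε c).comp (continuous_const.sub continuous_id)).aestronglyMeasurable
  have bd : ∀ c : MvPolynomial (Fin d ⊕ Fin d) ℂ, ∃ K : ℝ, ∀ x : PS d, ‖gP ε c x‖ ≤ K := fun c => by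
    obtain ⟨K, hK⟩ := gP_decay hε c 0
    exact ⟨K, fun x => by simpa using hK x⟩
  obtain ⟨K, hK⟩ := bd b
  obtain ⟨K', hK'⟩ := bd (gD ε j b)
  refine (hasDerivAt_integral_of_dominated_loc_of_deriv_le (μ := (volume : Measure (PS d)))
    (F := fun t w => W w * gP ε b (z + t • bvec j - w))
    (F' := fun t w => W w * gP ε (gD ε j b) (z + t • bvec j - w)) (bound := fun w => ‖W w‖ * K')
    (s := Set.univ) (x₀ := t) Filter.univ_mem
    (Filter.Eventually.of_forall fun t => meas b _) ?_ (meas _ _) ?_ (hW.norm.mul_const K') ?_).2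
  · refine (hW.norm.mul_const K).mono' (meas _ _) (Filter.Eventually.of_forall fun w => ?_)
    rw [norm_mul]
    gcongr
    exact hK _
  · refine Filter.Eventually.of_forall fun w t _ => ?_
    rw [norm_mul]
    gcongr
    exact hK' _
  · refine Filter.Eventually.of_forall fun w t _ => ?_
    have := (hasDerivAt_gP ε b (z - w) j t).const_mul (W w)
    have e : ∀ t : ℝ, z + t • bvec j - w = z - w + t • bvec j := fun t => by abel
    simp only [e]
    exact this

lemma upd_inl (z : PS d) (i : Fin d) (t : ℝ) :
    (Function.update z.1 i t, z.2) = z + (t - z.1 i) • (bvec (Sum.inl i) : PS d) := by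
  refine Prod.ext (funext fun k => ?_) (by simp [bvec])
  by_cases h : k = i
  · subst h; simp [bvec]
  · simp [bvec, h]

lemma upd_inr (z : PS d) (i : Fin d) (t : ℝ) :
    (z.1, Function.update z.2 i t) = z + (t - z.2 i) • (bvec (Sum.inr i) : PS d) := by
  refine Prod.ext (by simp [bvec]) (funext fun k => ?_)
  by_cases h : k = i
  · subst h; simp [bvec]
  · simp [bvec, h]

lemma cv_second {W : PS d → ℂ} (hW : Integrable W) {ε : ℝ} (hε : 0 < ε)
    (b : MvPolynomial (Fin d ⊕ Fin d) ℂ) (z : PS d) (j) (s : ℝ) :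
    iteratedDeriv 2 (fun t : ℝ => cv W ε b (z + (t - s) • bvec j)) s =
      cv W ε (gD ε j (gD ε j b)) z := by
  have h : ∀ (c : MvPolynomial (Fin d ⊕ Fin d) ℂ) (t : ℝ),
      HasDerivAt (fun t : ℝ => cv W ε c (z + (t - s) • bvec j))
        (cv W ε (gD ε j c) (z + (t - s) • bvec j)) t := fun c t =>
    HasDerivAt.comp_sub_const t s (cv_hasDerivAt hW hε c z j (t - s))
  have h1 : deriv (fun t : ℝ => cv W ε b (z + (t - s) • bvec j)) =
      fun t : ℝ => cv W ε (gD ε j b) (z + (t - s) • bvec j) := funext fun t => (h b t).deriv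
  rw [iteratedDeriv_succ', iteratedDeriv_one, h1, (h _ s).deriv]
  simp

lemma cv_sum {W : PS d → ℂ} (hW : Integrable W) {ε : ℝ} (hε : 0 < ε)
    {ι : Type*} (s : Finset ι)
    (b : ι → MvPolynomial (Fin d ⊕ Fin d) ℂ) (z : PS d) :
    cv W ε (∑ i ∈ s, b i) z = ∑ i ∈ s, cv W ε (b i) z := by
  unfold cv
  rw [← integral_finsetSum]
  · congr 1
    funext w
    simp [gP, polyEval, Finset.sum_mul, Finset.mul_sum]
  · intro i _
    obtain ⟨K, hK⟩ := gP_decay hε (b i) 0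
    refine (hW.norm.mul_const K).mono' (hW.aestronglyMeasurable.mul
      ((continuous_gP ε (b i)).comp (continuous_const.sub continuous_id)).aestronglyMeasurable)
      (Filter.Eventually.of_forall fun w => ?_)
    rw [norm_mul]
    gcongr
    simpa using hK (z - w)

lemma phaseLap_cv {W : PS d → ℂ} (hW : Integrable W) {ε : ℝ} (hε : 0 < ε)
    (b : MvPolynomial (Fin d ⊕ Fin d) ℂ) :
    phaseLap (cv W ε b) = cv W ε (gLap ε b) := by
  funext z
  simp only [phaseLap, upd_inl, upd_inr, cv_second hW hε]
  rw [gLap, cv_sum hW hε, Fintype.sum_sum_type]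

lemma phaseLap_iter_cv {W : PS d → ℂ} (hW : Integrable W) {ε : ℝ} (hε : 0 < ε) (m : ℕ)
    (b : MvPolynomial (Fin d ⊕ Fin d) ℂ) :
    phaseLap^[m] (cv W ε b) = cv W ε ((gLap ε)^[m] b) := by
  induction m with
  | zero => rfl
  | succ m ih => rw [Function.iterate_succ_apply', Function.iterate_succ_apply', ih,
      phaseLap_cv hW hε]

lemma prod_integrable {W : PS d → ℂ} (hm : AEStronglyMeasurable W volume)
    (hW : ∀ k : ℕ, Integrable (fun w => (1 + ‖w‖) ^ k * ‖W w‖)) {ε : ℝ} (hε : 0 < ε)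
    (a b : MvPolynomial (Fin d ⊕ Fin d) ℂ) :
    Integrable (fun x : PS d × PS d => polyEval a (x.1 + x.2) * (W x.2 * gP ε b x.1))
      (volume.prod volume) := by
  obtain ⟨c, n, hc, h⟩ := polyEval_bound a
  refine (((gP_integrable hε b n).mul_prod (hW n)).const_mul c).mono' ?_ ?_
  · refine AEStronglyMeasurable.mul ?_ (AEStronglyMeasurable.mul ?_ ?_)
    · exact ((continuous_polyEval a).comp
        (continuous_fst.add continuous_snd)).aestronglyMeasurable
    · exact hm.comp_snd
    · exact ((continuous_gP ε b).comp continuous_fst).aestronglyMeasurable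
  · refine Filter.Eventually.of_forall fun x => ?_
    rw [norm_mul, norm_mul]
    have h1 : 1 + ‖x.1 + x.2‖ ≤ (1 + ‖x.1‖) * (1 + ‖x.2‖) := by
      nlinarith [norm_add_le x.1 x.2, mul_nonneg (norm_nonneg x.1) (norm_nonneg x.2)]
    have h2 : ‖polyEval a (x.1 + x.2)‖ ≤ c * ((1 + ‖x.1‖) * (1 + ‖x.2‖)) ^ n :=
      (h _).trans (by gcongr)
    calc _ ≤ (c * ((1 + ‖x.1‖) * (1 + ‖x.2‖)) ^ n) * (‖W x.2‖ * ‖gP ε b x.1‖) := by gcongr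
      _ = _ := by rw [mul_pow]; ring

lemma inner_integral (W : PS d → ℂ) {ε : ℝ} (hε : 0 < ε)
    (a b : MvPolynomial (Fin d ⊕ Fin d) ℂ) (w : PS d) :
    ∫ u, polyEval a (u + w) * (W w * gP ε b u) =
      W w * gT hε (polyShift (fun j => (crd w j : ℂ)) a * b) := by
  rw [gT_apply, ← integral_const_mul]
  congr 1
  funext u
  have : polyEval (polyShift (fun j => (crd w j : ℂ)) a) u = polyEval a (u + w) := by
    rw [polyEval_eq, polyShift_eval, polyEval_eq]
    congr 2
    funext j
    rw [crd_add]; push_cast; rfl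
  rw [gP, gP, polyEval_mul, this]
  ring

lemma fubini_main {W : PS d → ℂ} (hm : AEStronglyMeasurable W volume)
    (hW : ∀ k : ℕ, Integrable (fun w => (1 + ‖w‖) ^ k * ‖W w‖)) {ε : ℝ} (hε : 0 < ε)
    (a b : MvPolynomial (Fin d ⊕ Fin d) ℂ) :
    Integrable (fun z => polyEval a z * cv W ε b z) ∧
    Integrable (fun w => W w * gT hε (polyShift (fun j => (crd w j : ℂ)) a * b)) ∧
    ∫ z, polyEval a z * cv W ε b z =
      ∫ w, W w * gT hε (polyShift (fun j => (crd w j : ℂ)) a * b) := by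
  have := volPS_haar (d := d)
  have hG := prod_integrable hm hW hε a b
  have hF : Integrable (fun x : PS d × PS d => polyEval a x.1 * (W x.2 * gP ε b (x.1 - x.2)))
      (volume.prod volume) := by
    have := (measurePreserving_sub_prod (volume : Measure (PS d))
      (volume : Measure (PS d))).integrable_comp_of_integrable hG
    refine this.congr (Filter.Eventually.of_forall fun x => ?_)
    simp
  refine ⟨?_, ?_, ?_⟩
  · have := hF.integral_prod_left
    simpa only [integral_const_mul, cv] using this
  · have := hG.integral_prod_right
    simpa only [inner_integral W hε] using this
  · calc ∫ z, polyEval a z * cv W ε b z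
        = ∫ z, ∫ w, polyEval a z * (W w * gP ε b (z - w)) := by
          simp only [integral_const_mul, cv]
      _ = ∫ w, ∫ z, polyEval a z * (W w * gP ε b (z - w)) := integral_integral_swap hF
      _ = ∫ w, ∫ u, polyEval a (u + w) * (W w * gP ε b u) := by
          congr 1
          funext w
          rw [← integral_add_right_eq_self _ w]
          simp
      _ = _ := by simp only [inner_integral W hε]

theorem main_of_decay (ε : ℝ) (hε : 0 < ε) (N : ℕ) (hN : 1 ≤ N)
    (ψ : (Fin d → ℝ) → ℂ) (hm : AEStronglyMeasurable (wigner ε ψ) volume)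
    (hW : ∀ k : ℕ, Integrable (fun w => (1 + ‖w‖) ^ k * ‖wigner ε ψ w‖))
    (a : MvPolynomial (Fin d ⊕ Fin d) ℂ) (ha : a.totalDegree < 2 * N) :
    ∫ z : PS d, polyEval a z * wigner ε ψ z =
      ∫ z : PS d, polyEval a z * specDensity ε ψ N z := by
  have hI := W_integrable hm hW
  have key := fun m : ℕ => fubini_main hm hW hε a ((gLap ε)^[m] 1)
  have e1 : ∀ z, polyEval a z * specDensity ε ψ N z = ∑ m ∈ Finset.range N,
      ((Nat.factorial m : ℂ))⁻¹ * (-(ε : ℂ) / 4) ^ m *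
        (polyEval a z * cv (wigner ε ψ) ε ((gLap ε)^[m] 1) z) := by
    intro z
    rw [specDensity, Finset.mul_sum]
    refine Finset.sum_congr rfl fun m _ => ?_
    rw [husimi_eq_cv, phaseLap_iter_cv hI hε]
    ring
  simp only [e1]
  rw [integral_finsetSum _ fun m _ => (key m).1.const_mul _]
  simp only [integral_const_mul, (key _).2.2]
  simp only [← integral_const_mul]
  rw [← integral_finsetSum _ fun m _ => (key m).2.1.const_mul _]
  congr 1
  funext w
  have hsum := gauss_sum_identity (ε : ℂ) (gT (d := d) hε) (gT_one hε) (gT_X_mul hε) N hN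
    (polyShift (fun j => (crd w j : ℂ)) a) ((polyShift_totalDegree _ _).trans_lt ha)
  rw [polyShift_constantCoeff, ← polyEval_eq] at hsum
  rw [← hsum, Finset.sum_mul]
  refine Finset.sum_congr rfl fun m _ => ?_
  rw [gT_mul_gLap_iter]
  ring

end ConvPart

section WignerPart
open MvPolynomial

variable {d : ℕ}

/-- The function whose Fourier transform is the Wigner function. -/
def wPhi (ψ : SchwartzMap (Fin d → ℝ) ℂ) (q y : Fin d → ℝ) : ℂ :=
  ψ (q + (-(1 / 2) : ℝ) • y) * (starRingEnd ℂ) (ψ (q + (1 / 2 : ℝ) • y))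

lemma norm_iteratedFDeriv_affine (f : (Fin d → ℝ) → ℂ) (hf : ContDiff ℝ (⊤ : ℕ∞) f)
    (q y : Fin d → ℝ) (c : ℝ) (hc : |c| ≤ 1) (i : ℕ) :
    ‖iteratedFDeriv ℝ i (fun y => f (q + c • y)) y‖ ≤ ‖iteratedFDeriv ℝ i f (q + c • y)‖ := by
  have h1 : ContDiff ℝ i (fun x => f (q + x)) :=
    (hf.comp (contDiff_const.add contDiff_id)).of_le (by exact_mod_cast le_top)
  have := congrFun (iteratedFDeriv_comp_const_smul c h1) y
  rw [this, iteratedFDeriv_comp_add_left, norm_smul, norm_pow, Real.norm_eq_abs]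
  exact mul_le_of_le_one_left (norm_nonneg _) (pow_le_one₀ (abs_nonneg _) hc)

lemma contDiff_conj (ψ : SchwartzMap (Fin d → ℝ) ℂ) :
    ContDiff ℝ (⊤ : ℕ∞) (fun x => (starRingEnd ℂ) (ψ x)) :=
  Complex.conjCLE.contDiff.comp (ψ.smooth ⊤)

lemma contDiff_aff (q : Fin d → ℝ) (c : ℝ) :
    ContDiff ℝ (⊤ : ℕ∞) (fun y : Fin d → ℝ => q + c • y) := by fun_prop

lemma contDiff_wPhi (ψ : SchwartzMap (Fin d → ℝ) ℂ) (q : Fin d → ℝ) :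
    ContDiff ℝ (⊤ : ℕ∞) (wPhi ψ q) := by
  unfold wPhi
  exact ((ψ.smooth ⊤).comp (contDiff_aff q _)).mul
    ((contDiff_conj ψ).comp (contDiff_aff q _))

lemma norm_iteratedFDeriv_conj (ψ : SchwartzMap (Fin d → ℝ) ℂ) (x : Fin d → ℝ) (i : ℕ) :
    ‖iteratedFDeriv ℝ i (fun x => (starRingEnd ℂ) (ψ x)) x‖ = ‖iteratedFDeriv ℝ i ψ x‖ :=
  Complex.conjLIE.norm_iteratedFDeriv_comp_left (⇑ψ) x i

lemma wPhi_decay (ψ : SchwartzMap (Fin d → ℝ) ℂ) (k n : ℕ) :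
    ∃ c : ℝ, 0 ≤ c ∧ ∀ q y : Fin d → ℝ,
      ((1 + ‖q‖) * (1 + ‖y‖)) ^ k * ‖iteratedFDeriv ℝ n (wPhi ψ q) y‖ ≤ c := by
  obtain ⟨M, hM⟩ : ∃ M : ℝ, ∀ i ≤ n, ∀ x, (1 + ‖x‖) ^ (2 * k) * ‖iteratedFDeriv ℝ i ψ x‖ ≤ M :=
    ⟨_, fun i hi x => SchwartzMap.one_add_le_sup_seminorm_apply (𝕜 := ℝ) (m := (2 * k, n))
      (k := 2 * k) (n := i) le_rfl hi ψ x⟩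
  have hM0 : 0 ≤ M := le_trans (by positivity) (hM 0 (Nat.zero_le _) 0)
  refine ⟨∑ i ∈ Finset.range (n + 1), (n.choose i : ℝ) * (M * M), by positivity, fun q y => ?_⟩
  have hb := norm_iteratedFDeriv_mul_le (𝕜 := ℝ) (n := n) (N := (⊤ : ℕ∞))
    (f := fun y => ψ (q + (-(1 / 2) : ℝ) • y))
    (g := fun y => (starRingEnd ℂ) (ψ (q + (1 / 2 : ℝ) • y)))
    ((ψ.smooth ⊤).comp (contDiff_aff q _))
    ((contDiff_conj ψ).comp (contDiff_aff q _)) y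
    (by exact_mod_cast le_top)
  set A := q + (-(1 / 2) : ℝ) • y with hA
  set B := q + (1 / 2 : ℝ) • y with hB
  have hq : q = (1 / 2 : ℝ) • (A + B) := by
    rw [hA, hB]; module
  have hy : y = B - A := by
    rw [hA, hB]; module
  have nA := norm_nonneg A
  have nB := norm_nonneg B
  have h1 : 1 + ‖q‖ ≤ (1 + ‖A‖) * (1 + ‖B‖) := by
    have : ‖q‖ ≤ 1 / 2 * (‖A‖ + ‖B‖) := by
      rw [hq, norm_smul]
      have := norm_add_le A B
      norm_num
      linarith
    nlinarith
  have h2 : 1 + ‖y‖ ≤ (1 + ‖A‖) * (1 + ‖B‖) := by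
    have : ‖y‖ ≤ ‖B‖ + ‖A‖ := by
      rw [hy]; exact norm_sub_le B A
    nlinarith
  have h3 : ((1 + ‖q‖) * (1 + ‖y‖)) ^ k ≤ (1 + ‖A‖) ^ (2 * k) * (1 + ‖B‖) ^ (2 * k) := by
    calc _ ≤ (((1 + ‖A‖) * (1 + ‖B‖)) * ((1 + ‖A‖) * (1 + ‖B‖))) ^ k := by gcongr
      _ = _ := by rw [pow_mul, pow_mul, ← mul_pow]; congr 1; ring
  calc ((1 + ‖q‖) * (1 + ‖y‖)) ^ k * ‖iteratedFDeriv ℝ n (wPhi ψ q) y‖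
      ≤ ((1 + ‖A‖) ^ (2 * k) * (1 + ‖B‖) ^ (2 * k)) * ∑ i ∈ Finset.range (n + 1), (n.choose i : ℝ) *
        ‖iteratedFDeriv ℝ i (fun y => ψ (q + (-(1 / 2) : ℝ) • y)) y‖ *
        ‖iteratedFDeriv ℝ (n - i) (fun y => (starRingEnd ℂ) (ψ (q + (1 / 2 : ℝ) • y))) y‖ := by
        gcongr
        exact hb
    _ ≤ _ := by
        rw [Finset.mul_sum]
        refine Finset.sum_le_sum fun i hi => ?_
        have hi' : i ≤ n := by
          have := Finset.mem_range.1 hi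
          omega
        have e1 := norm_iteratedFDeriv_affine ψ (ψ.smooth ⊤) q y (-(1 / 2)) (by norm_num [abs_le]) i
        have e2 := norm_iteratedFDeriv_affine _ (contDiff_conj ψ) q y (1 / 2)
          (by norm_num [abs_le]) (n - i)
        rw [norm_iteratedFDeriv_conj] at e2
        have e1' := (mul_le_mul_of_nonneg_left e1 (by positivity)).trans (hM i hi' A)
        have e2' := (mul_le_mul_of_nonneg_left e2 (by positivity)).trans (hM (n - i) (by omega) B)
        have := mul_le_mul e1' e2' (by positivity) hM0
        calc _ = (n.choose i : ℝ) * (((1 + ‖A‖) ^ (2 * k) *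
              ‖iteratedFDeriv ℝ i (fun y => ψ (q + (-(1 / 2) : ℝ) • y)) y‖) *
              ((1 + ‖B‖) ^ (2 * k) * ‖iteratedFDeriv ℝ (n - i)
                (fun y => (starRingEnd ℂ) (ψ (q + (1 / 2 : ℝ) • y))) y‖)) := by ring
          _ ≤ _ := by gcongr

lemma wPhi_integral (ψ : SchwartzMap (Fin d → ℝ) ℂ) (k n : ℕ) :
    ∃ c : ℝ, 0 ≤ c ∧ ∀ q : Fin d → ℝ,
      Integrable (fun y => ‖iteratedFDeriv ℝ n (wPhi ψ q) y‖) ∧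
      (1 + ‖q‖) ^ k * ∫ y, ‖iteratedFDeriv ℝ n (wPhi ψ q) y‖ ≤ c := by
  obtain ⟨c, hc, h⟩ := wPhi_decay ψ (k + (d + 1)) n
  have hi := (integrable_one_add_norm (E := Fin d → ℝ) (μ := volume)
    (r := ((d + 1 : ℕ) : ℝ)) (by simp)).const_mul c
  have hbd : ∀ q y : Fin d → ℝ, (1 + ‖q‖) ^ k * ‖iteratedFDeriv ℝ n (wPhi ψ q) y‖ ≤
      c * (1 + ‖y‖) ^ (-((d + 1 : ℕ) : ℝ)) := by
    intro q y
    have h1 : 0 < 1 + ‖y‖ := by linarith [norm_nonneg y]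
    have h2 : 1 ≤ 1 + ‖q‖ := by linarith [norm_nonneg q]
    rw [Real.rpow_neg h1.le, Real.rpow_natCast, ← div_eq_mul_inv, le_div_iff₀ (by positivity)]
    refine le_trans ?_ (h q y)
    calc (1 + ‖q‖) ^ k * ‖iteratedFDeriv ℝ n (wPhi ψ q) y‖ * (1 + ‖y‖) ^ (d + 1)
        = ((1 + ‖q‖) ^ k * (1 + ‖y‖) ^ (d + 1)) * ‖iteratedFDeriv ℝ n (wPhi ψ q) y‖ := by ring
      _ ≤ ((1 + ‖q‖) ^ (k + (d + 1)) * (1 + ‖y‖) ^ (k + (d + 1))) *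
          ‖iteratedFDeriv ℝ n (wPhi ψ q) y‖ := by
          have h3 : 1 ≤ 1 + ‖y‖ := by linarith [norm_nonneg y]
          have i1 : (1 + ‖q‖) ^ k ≤ (1 + ‖q‖) ^ (k + (d + 1)) :=
            pow_le_pow_right₀ h2 (by omega)
          have i2 : (1 + ‖y‖) ^ (d + 1) ≤ (1 + ‖y‖) ^ (k + (d + 1)) :=
            pow_le_pow_right₀ h3 (by omega)
          gcongr
      _ = _ := by rw [mul_pow]
  have hInt : ∀ q : Fin d → ℝ, Integrable (fun y => ‖iteratedFDeriv ℝ n (wPhi ψ q) y‖) := by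
    intro q
    refine hi.mono' ?_ (Filter.Eventually.of_forall fun y => ?_)
    · exact ((contDiff_wPhi ψ q).continuous_iteratedFDeriv
        (by exact_mod_cast le_top)).norm.aestronglyMeasurable
    · rw [norm_norm]
      refine le_trans ?_ (hbd q y)
      have h2 : 1 ≤ 1 + ‖q‖ := by linarith [norm_nonneg q]
      exact le_mul_of_one_le_left (norm_nonneg _) (one_le_pow₀ h2)
  refine ⟨∫ y : Fin d → ℝ, c * (1 + ‖y‖) ^ (-((d + 1 : ℕ) : ℝ)),
    integral_nonneg fun y => by positivity, fun q => ⟨hInt q, ?_⟩⟩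
  rw [← integral_const_mul]
  exact integral_mono ((hInt q).const_mul _) hi fun y => hbd q y

/-- The scaled Euclidean pairing. -/
def pairL (d : ℕ) (ε : ℝ) : (Fin d → ℝ) →L[ℝ] (Fin d → ℝ) →L[ℝ] ℝ :=
  (-(2 * Real.pi * ε)⁻¹) • ∑ i : Fin d,
    (ContinuousLinearMap.proj (R := ℝ) (φ := fun _ : Fin d => ℝ) i).smulRight
      (ContinuousLinearMap.proj (R := ℝ) (φ := fun _ : Fin d => ℝ) i)

lemma pairL_apply (ε : ℝ) (v w : Fin d → ℝ) :
    pairL d ε v w = -(2 * Real.pi * ε)⁻¹ * ∑ i, v i * w i := by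
  simp [pairL, _root_.sum_apply]

lemma wigner_eq {ε : ℝ} (hε : 0 < ε) (ψ : SchwartzMap (Fin d → ℝ) ℂ) (z : PS d) :
    wigner ε ψ z = (((2 * Real.pi * ε) ^ d : ℝ))⁻¹ •
      VectorFourier.fourierIntegral Real.fourierChar volume (pairL d ε).toLinearMap₁₂
        (wPhi ψ z.1) z.2 := by
  unfold wigner VectorFourier.fourierIntegral
  congr 1
  congr 1
  funext y
  have hpi : (Real.pi : ℂ) ≠ 0 := by exact_mod_cast Real.pi_ne_zero
  have hne : (ε : ℂ) ≠ 0 := by exact_mod_cast hε.ne'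
  have e : (pairL d ε).toLinearMap₁₂ y z.2 = pairL d ε y z.2 := rfl
  rw [e, pairL_apply, Circle.smul_def, Real.fourierChar_apply, smul_eq_mul, mul_assoc, wPhi]
  congr 1
  · congr 1
    push_cast
    have : ∑ i, (y i : ℂ) * (z.2 i : ℂ) = ∑ i, (z.2 i : ℂ) * (y i : ℂ) :=
      Finset.sum_congr rfl fun i _ => mul_comm _ _
    rw [this]
    field_simp
  · congr 2
    · congr 1; funext i; simp; ring
    · congr 1; funext i; simp; ring

lemma wigner_meas (ε : ℝ) (ψ : SchwartzMap (Fin d → ℝ) ℂ) :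
    AEStronglyMeasurable (wigner ε ψ) volume := by
  have key : ∀ f : PS d → ℂ, StronglyMeasurable f →
      AEStronglyMeasurable (fun z => (((2 * Real.pi * ε) ^ d : ℝ))⁻¹ • f z) volume :=
    fun f hf => by
      have h := (stronglyMeasurable_const (b := (((2 * Real.pi * ε) ^ d : ℝ))⁻¹)).smul hf
      exact h.aestronglyMeasurable
  unfold wigner
  refine key _ ?_
  have hc : Continuous (fun x : PS d × (Fin d → ℝ) =>
      Complex.exp (Complex.I * (∑ i, x.1.2 i * x.2 i) / ε) *
        ψ (fun i => x.1.1 i - x.2 i / 2) *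
        (starRingEnd ℂ) (ψ (fun i => x.1.1 i + x.2 i / 2))) := by
    have hψ := ψ.continuous
    refine Continuous.mul (Continuous.mul (by fun_prop) (hψ.comp (by fun_prop)))
      (Complex.continuous_conj.comp (hψ.comp (by fun_prop)))
  exact StronglyMeasurable.integral_prod_right' hc.stronglyMeasurable

lemma wigner_decay (hd : 1 ≤ d) {ε : ℝ} (hε : 0 < ε) (ψ : SchwartzMap (Fin d → ℝ) ℂ) (k : ℕ) :
    ∃ c : ℝ, ∀ z : PS d, (1 + ‖z‖) ^ k * ‖wigner ε ψ z‖ ≤ c := by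
  choose c hc h using wPhi_integral ψ k
  have hpi := Real.pi_pos
  have F : ∀ n : ℕ, ∃ K : ℝ, ∀ z : PS d, (1 + ‖z.1‖) ^ k * (‖z.2‖ ^ n *
      ‖VectorFourier.fourierIntegral Real.fourierChar volume (pairL d ε).toLinearMap₁₂
        (wPhi ψ z.1) z.2‖) ≤ K := by
    intro n
    refine ⟨(2 * Real.pi * ε) ^ n * (2 ^ n * ∑ j ∈ Finset.range (n + 1), c j), fun z => ?_⟩
    have : Nonempty (Fin d) := ⟨⟨0, hd⟩⟩
    obtain ⟨i, hi⟩ : ∃ i, ‖z.2‖ = |z.2 i| := by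
      obtain ⟨i, hi⟩ := Finite.exists_max (fun i => ‖z.2 i‖)
      exact ⟨i, le_antisymm ((pi_norm_le_iff_of_nonneg (norm_nonneg _)).2 hi)
        (norm_le_pi_norm z.2 i)⟩
    have key := VectorFourier.pow_mul_norm_iteratedFDeriv_fourierIntegral_le (pairL d ε)
      (μ := (volume : Measure (Fin d → ℝ))) (K := 0) (N := ⊤) (f := wPhi ψ z.1)
      (contDiff_wPhi ψ z.1) (fun k' n' hk' _ => by
        have : k' = 0 := by simpa using hk'
        subst this
        simpa using (h n' z.1).1) (k := 0) (n := n) le_rfl le_top (Pi.single i 1) z.2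
    rw [norm_iteratedFDeriv_zero, pairL_apply] at key
    have s1 : ∑ l, (Pi.single i 1 : Fin d → ℝ) l * z.2 l = z.2 i := by
      simp [Pi.single_apply]
    have s2 : ‖(Pi.single i 1 : Fin d → ℝ)‖ = 1 := by simp [Pi.norm_single]
    rw [s1, s2, abs_mul, abs_neg, abs_of_pos (by positivity : 0 < (2 * Real.pi * ε)⁻¹), ← hi] at key
    simp only [one_pow, pow_zero, mul_one, one_mul, Nat.cast_zero, mul_zero, zero_add,
      Finset.range_one, Finset.singleton_product, Finset.sum_map, Function.Embedding.coeFn_mk,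
      mul_pow, inv_pow] at key
    set Fz := ‖VectorFourier.fourierIntegral Real.fourierChar volume (pairL d ε).toLinearMap₁₂
        (wPhi ψ z.1) z.2‖
    have key2 : ‖z.2‖ ^ n * Fz ≤ (2 * Real.pi * ε) ^ n * (2 ^ n * ∑ j ∈ Finset.range (n + 1),
        ∫ y, ‖iteratedFDeriv ℝ j (wPhi ψ z.1) y‖) := by
      have e : ‖z.2‖ ^ n * Fz = (2 * Real.pi * ε) ^ n *
          ((2 ^ n * Real.pi ^ n * ε ^ n)⁻¹ * ‖z.2‖ ^ n * Fz) := by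
        field_simp
        ring
      rw [e]
      gcongr
    calc _ ≤ (1 + ‖z.1‖) ^ k * ((2 * Real.pi * ε) ^ n * (2 ^ n * ∑ j ∈ Finset.range (n + 1),
        ∫ y, ‖iteratedFDeriv ℝ j (wPhi ψ z.1) y‖)) := by gcongr
      _ = (2 * Real.pi * ε) ^ n * (2 ^ n * ∑ j ∈ Finset.range (n + 1),
        (1 + ‖z.1‖) ^ k * ∫ y, ‖iteratedFDeriv ℝ j (wPhi ψ z.1) y‖) := by
          rw [← Finset.mul_sum]; ring
      _ ≤ _ := by
          gcongr with j _
          exact (h j z.1).2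
  obtain ⟨K0, h0⟩ := F 0
  obtain ⟨K1, h1⟩ := F k
  refine ⟨(((2 * Real.pi * ε) ^ d : ℝ))⁻¹ * (2 ^ (k - 1) * (K0 + K1)), fun z => ?_⟩
  rw [wigner_eq hε, norm_smul, Real.norm_of_nonneg (by positivity)]
  have g0 := h0 z
  have g1 := h1 z
  set Fz := ‖VectorFourier.fourierIntegral Real.fourierChar volume (pairL d ε).toLinearMap₁₂
        (wPhi ψ z.1) z.2‖
  have n1 := norm_nonneg z.1
  have n2 := norm_nonneg z.2
  have e1 : 1 + ‖z‖ ≤ (1 + ‖z.1‖) * (1 + ‖z.2‖) := by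
    rw [Prod.norm_def]
    rcases max_cases ‖z.1‖ ‖z.2‖ with ⟨h, _⟩ | ⟨h, _⟩ <;> rw [h] <;> nlinarith
  have e2 : (1 + ‖z.2‖) ^ k ≤ 2 ^ (k - 1) * (1 + ‖z.2‖ ^ k) := by
    simpa using add_pow_le zero_le_one n2 k
  have e3 : (1 + ‖z‖) ^ k ≤ (1 + ‖z.1‖) ^ k * (2 ^ (k - 1) * (1 + ‖z.2‖ ^ k)) := by
    calc _ ≤ ((1 + ‖z.1‖) * (1 + ‖z.2‖)) ^ k := by gcongr
      _ = (1 + ‖z.1‖) ^ k * (1 + ‖z.2‖) ^ k := mul_pow _ _ _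
      _ ≤ _ := by gcongr
  calc (1 + ‖z‖) ^ k * ((((2 * Real.pi * ε) ^ d : ℝ))⁻¹ * Fz)
      ≤ ((1 + ‖z.1‖) ^ k * (2 ^ (k - 1) * (1 + ‖z.2‖ ^ k))) *
        ((((2 * Real.pi * ε) ^ d : ℝ))⁻¹ * Fz) := by
        gcongr
    _ = (((2 * Real.pi * ε) ^ d : ℝ))⁻¹ * (2 ^ (k - 1) * ((1 + ‖z.1‖) ^ k * (‖z.2‖ ^ 0 * Fz) +
        (1 + ‖z.1‖) ^ k * (‖z.2‖ ^ k * Fz))) := by ring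
    _ ≤ _ := by gcongr

end WignerPart

/-- Exactness for polynomial observables: if `a` is a polynomial of total degree `< 2N`
and `ψ` is Schwartz, then `∫ a W_ψ = ∫ a μ_ψ^N`. -/
theorem spectrogram_expansion_polynomial_exact
    (d : ℕ) (hd : 1 ≤ d) (ε : ℝ) (hε : 0 < ε) (N : ℕ) (hN : 1 ≤ N)
    (ψ : SchwartzMap (Fin d → ℝ) ℂ)
    (a : MvPolynomial (Fin d ⊕ Fin d) ℂ) (ha : a.totalDegree < 2 * N) :
    ∫ z : PS d, polyEval a z * wigner ε (⇑ψ) z =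
      ∫ z : PS d, polyEval a z * specDensity ε (⇑ψ) N z := by
  have := volPS_haar (d := d)
  exact main_of_decay ε hε N hN ψ (wigner_meas ε ψ)
    (integrable_of_decay _ (wigner_meas ε ψ) (wigner_decay hd hε ψ)) a ha
end
end

section
/- Pointwise kernel identity underlying the spectrogram expansion: Let ε > 0, d ≥ 1 and N ≥ 1. Then for every z ∈ ℝ^{2d}, Σ_{m=0}^{N−1} (1/m!) (−ε/4)^m Δ^m W_0(z) = Σ_{j=0}^{N−1} (−1)^j C_{N−1,j} Σ_{k ∈ ℕ^d, |k| = j} W_k(z), where C_{k,j} = Σ_{m=j}^{k} 2^{−m} binom(d−1+m, d−1+j) and Δ is the Laplacian on ℝ^{2d}. -/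
open Finset

noncomputable section

/-- The `n`-th Laguerre polynomial. -/
def laguerre (n : ℕ) (x : ℝ) : ℝ :=
  ∑ j ∈ Finset.range (n + 1), (n.choose (n - j) : ℝ) * (-x) ^ j / (Nat.factorial j)

/-- The ε-scaled Wigner function of the `k`-th Hermite function. -/
def wignerHermite {d : ℕ} (ε : ℝ) (k : Fin d → ℕ) : PS d → ℝ := fun z =>
  (((Real.pi * ε) ^ d : ℝ))⁻¹ * Real.exp (-(∑ i, (z.1 i ^ 2 + z.2 i ^ 2)) / ε) *
    (-1 : ℝ) ^ (∑ i, k i) * ∏ i, laguerre (k i) (2 / ε * (z.1 i ^ 2 + z.2 i ^ 2))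

/-- The coefficients `C_{k,j} = Σ_{m=j}^{k} 2^{−m} binom(d−1+m, d−1+j)`. -/
def specCoeff (d k j : ℕ) : ℝ :=
  ∑ m ∈ Finset.Icc j k, ((2 : ℝ) ^ m)⁻¹ * ((d - 1 + m).choose (d - 1 + j) : ℝ)

open Polynomial in
/-- generalized Laguerre polynomial with integer parameter -/
def lagP (α n : ℕ) : Polynomial ℝ :=
  ∑ i ∈ Finset.range (n + 1), Polynomial.monomial i
    (((n + α).choose (i + α) : ℝ) * (-1) ^ i / (Nat.factorial i))

lemma lagP_coeff (α n i : ℕ) : (lagP α n).coeff i =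
    ((n + α).choose (i + α) : ℝ) * (-1) ^ i / (Nat.factorial i) := by
  unfold lagP
  rw [Polynomial.finsetSum_coeff]
  simp only [Polynomial.coeff_monomial]
  rw [Finset.sum_ite_eq' (Finset.range (n+1)) i]
  split_ifs with h
  · rfl
  · rw [Nat.choose_eq_zero_of_lt]
    · simp
    · simp at h; omega

lemma lagP_eval (α n K : ℕ) (h : n < K) (x : ℝ) : (lagP α n).eval x =
    ∑ i ∈ Finset.range K, ((n + α).choose (i + α) : ℝ) * ((-x) ^ i / (Nat.factorial i)) := by
  rw [Polynomial.eval_eq_sum_range' (n := K)]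
  · refine Finset.sum_congr rfl fun i _ => ?_
    rw [lagP_coeff, neg_pow x]; ring
  · refine lt_of_le_of_lt (Polynomial.natDegree_sum_le_of_forall_le _ _ (n := n) ?_) h
    intro i hi
    refine (Polynomial.natDegree_monomial_le _).trans ?_
    simp at hi; omega

lemma laguerre_eq (n : ℕ) (x : ℝ) : laguerre n x = (lagP 0 n).eval x := by
  rw [lagP_eval 0 n (n+1) (by omega)]
  unfold laguerre
  refine Finset.sum_congr rfl fun i hi => ?_
  rw [Nat.choose_symm (by simp at hi; omega)]
  simp [mul_div_assoc]

lemma vand (α q : ℕ) : ∀ n p : ℕ, ∑ ab ∈ Finset.HasAntidiagonal.antidiagonal n,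
    ab.1.choose p * (ab.2 + α).choose (q + α) = (n + α + 1).choose (p + q + α + 1) := by
  intro n
  induction n with
  | zero =>
    intro p
    simp only [Finset.Nat.antidiagonal_zero, Finset.sum_singleton]
    rcases Nat.eq_zero_or_pos p with rfl | hp
    · rcases Nat.eq_zero_or_pos q with rfl | hq
      · simp
      · rw [Nat.choose_eq_zero_of_lt (by omega : 0 + α < q + α),
          Nat.choose_eq_zero_of_lt (by omega : 0 + α + 1 < _)]; simp
    · rw [Nat.choose_eq_zero_of_lt hp, Nat.choose_eq_zero_of_lt (by omega : 0 + α + 1 < _)]; simp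
  | succ n ih =>
    intro p
    rw [Finset.Nat.antidiagonal_succ, Finset.sum_cons, Finset.sum_map]
    simp only [Function.Embedding.prodMap, Function.Embedding.coeFn_mk, Prod.map,
      Nat.succ_eq_add_one, Function.Embedding.refl_apply]
    cases p with
    | zero =>
      have := ih 0
      simp only [Nat.choose_zero_right] at this ⊢
      have e := Nat.choose_succ_succ (n + α + 1) (q + α)
      rw [this, show n + 1 + α + 1 = (n + α + 1) + 1 by ring,
        show n + 1 + α = n + α + 1 by ring, show 0 + q + α + 1 = (q + α).succ by omega]
      rw [e, one_mul]
    | succ p =>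
      simp only [Nat.choose_succ_succ, Nat.succ_eq_add_one, add_mul, Finset.sum_add_distrib]
      rw [ih p, ih (p+1), show n + 1 + α = n + α + 1 by ring,
        show p + 1 + q + α = p + q + α + 1 by ring]
      simp

lemma lag_add (α n : ℕ) (x y : ℝ) :
    ∑ ab ∈ Finset.HasAntidiagonal.antidiagonal n, (lagP 0 ab.1).eval x * (lagP α ab.2).eval y =
      (lagP (α + 1) n).eval (x + y) := by
  have h1 : ∀ ab ∈ Finset.HasAntidiagonal.antidiagonal n, (lagP 0 ab.1).eval x * (lagP α ab.2).eval y =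
      ∑ p ∈ Finset.range (n+1), ∑ q ∈ Finset.range (n+1),
        ((ab.1.choose p * (ab.2 + α).choose (q + α) : ℕ) : ℝ) *
          ((-x) ^ p / (Nat.factorial p) * ((-y) ^ q / (Nat.factorial q))) := by
    intro ab hab
    rw [Finset.HasAntidiagonal.mem_antidiagonal] at hab
    rw [lagP_eval 0 ab.1 (n+1) (by omega), lagP_eval α ab.2 (n+1) (by omega),
      Finset.sum_mul_sum]
    refine Finset.sum_congr rfl fun p _ => Finset.sum_congr rfl fun q _ => ?_
    push_cast
    simp only [add_zero]
    ring
  rw [Finset.sum_congr rfl h1, Finset.sum_comm]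
  have h2 : ∀ p ∈ Finset.range (n+1), ∑ ab ∈ Finset.HasAntidiagonal.antidiagonal n, ∑ q ∈ Finset.range (n+1),
        ((ab.1.choose p * (ab.2 + α).choose (q + α) : ℕ) : ℝ) *
          ((-x) ^ p / (Nat.factorial p) * ((-y) ^ q / (Nat.factorial q))) =
      ∑ q ∈ Finset.range (n+1), ((n + α + 1).choose (p + q + α + 1) : ℝ) *
          ((-x) ^ p / (Nat.factorial p) * ((-y) ^ q / (Nat.factorial q))) := by
    intro p _
    rw [Finset.sum_comm]
    refine Finset.sum_congr rfl fun q _ => ?_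
    rw [← Finset.sum_mul, ← Nat.cast_sum, vand]
  rw [Finset.sum_congr rfl h2, lagP_eval (α+1) n (n+1) (by omega)]
  have h3 : ∀ i ∈ Finset.range (n+1), ((n + (α+1)).choose (i + (α+1)) : ℝ) *
      ((-(x+y)) ^ i / (Nat.factorial i)) = ∑ pq ∈ Finset.HasAntidiagonal.antidiagonal i,
        ((n + α + 1).choose (pq.1 + pq.2 + α + 1) : ℝ) *
          ((-x) ^ pq.1 / (Nat.factorial pq.1) * ((-y) ^ pq.2 / (Nat.factorial pq.2))) := by
    intro i _
    have : (-(x+y)) ^ i / (Nat.factorial i : ℝ) = ∑ pq ∈ Finset.HasAntidiagonal.antidiagonal i,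
          ((-x) ^ pq.1 / (Nat.factorial pq.1) * ((-y) ^ pq.2 / (Nat.factorial pq.2))) := by
      rw [neg_add, (Commute.all (-x) (-y)).add_pow', Finset.sum_div]
      refine Finset.sum_congr rfl fun pq hpq => ?_
      rw [Finset.HasAntidiagonal.mem_antidiagonal] at hpq
      subst hpq
      have := Nat.add_choose_mul_factorial_mul_factorial pq.1 pq.2
      have h' : (((pq.1+pq.2).choose pq.1 : ℕ):ℝ) * (Nat.factorial pq.1) * (Nat.factorial pq.2)
        = (Nat.factorial (pq.1 + pq.2)) := by
        rw [← Nat.choose_symm_add] at this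
        exact_mod_cast this
      have a1 : (Nat.factorial pq.1 : ℝ) ≠ 0 := by positivity
      have a2 : (Nat.factorial pq.2 : ℝ) ≠ 0 := by positivity
      have a3 : (Nat.factorial (pq.1+pq.2) : ℝ) ≠ 0 := by positivity
      rw [nsmul_eq_mul]
      field_simp
      rw [← h']; ring
    rw [this, Finset.mul_sum]
    refine Finset.sum_congr rfl fun pq hpq => ?_
    rw [Finset.HasAntidiagonal.mem_antidiagonal] at hpq
    rw [← hpq]; rfl
  rw [Finset.sum_congr rfl h3, Finset.sum_sigma', Finset.sum_sigma']
  symm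
  refine Finset.sum_of_injOn (fun s => ⟨s.2.1, s.2.2⟩) ?_ ?_ ?_ ?_
  · rintro ⟨i, a, b⟩ h ⟨i', a', b'⟩ h' he
    simp at h h' he ⊢
    obtain ⟨rfl, rfl⟩ := he
    obtain ⟨_, rfl⟩ := h
    obtain ⟨_, rfl⟩ := h'
    simp
  · rintro ⟨i, a, b⟩ h
    simp at h ⊢
    omega
  · rintro ⟨a, b⟩ h hn
    rw [Nat.choose_eq_zero_of_lt]
    · simp
    · by_contra hc
      apply hn
      refine ⟨⟨a + b, a, b⟩, ?_, rfl⟩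
      simp at hc ⊢
      omega
  · rintro ⟨i, a, b⟩ h
    rfl

lemma sum_tuple_succ (d n : ℕ) (f : (Fin (d+1) → ℕ) → ℝ) :
    ∑ k ∈ Finset.Nat.antidiagonalTuple (d+1) n, f k =
    ∑ ab ∈ Finset.HasAntidiagonal.antidiagonal n, ∑ k ∈ Finset.Nat.antidiagonalTuple d ab.2,
      f (Fin.cons ab.1 k) := by
  rw [Finset.sum_sigma']
  refine Finset.sum_bij' (fun k _ => ⟨(k 0, ∑ i : Fin d, k i.succ), Fin.tail k⟩)
    (fun s _ => Fin.cons s.1.1 s.2) ?_ ?_ ?_ ?_ ?_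
  · intro k hk
    rw [Finset.Nat.mem_antidiagonalTuple, Fin.sum_univ_succ] at hk
    simp [Finset.Nat.mem_antidiagonalTuple, hk, Fin.tail]
  · rintro ⟨⟨a, b⟩, k⟩ h
    simp [Finset.Nat.mem_antidiagonalTuple] at h
    simp [Finset.Nat.mem_antidiagonalTuple, Fin.sum_univ_succ, h]
  · intro k _
    simp
  · rintro ⟨⟨a, b⟩, k⟩ h
    simp [Finset.Nat.mem_antidiagonalTuple] at h
    simp [h]
  · intro k _
    simp

lemma lag_tuple (α : ℕ) : ∀ (n : ℕ) (x : Fin (α+1) → ℝ),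
    ∑ k ∈ Finset.Nat.antidiagonalTuple (α+1) n, ∏ i, (lagP 0 (k i)).eval (x i) =
      (lagP α n).eval (∑ i, x i) := by
  induction α with
  | zero => intro n x; simp
  | succ α ih =>
    intro n x
    rw [sum_tuple_succ, Fin.sum_univ_succ, ← lag_add]
    refine Finset.sum_congr rfl fun ab _ => ?_
    rw [← ih, Finset.mul_sum]
    refine Finset.sum_congr rfl fun k _ => ?_
    rw [Fin.prod_univ_succ]
    simp

lemma choose_sum (α m i : ℕ) (hi : i ≤ m) :
    ∑ j ∈ Finset.range (m+1), (α + m).choose (α + j) * (j + α).choose (i + α) =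
      2 ^ (m - i) * (m + α).choose (i + α) := by
  obtain ⟨r, rfl⟩ := Nat.exists_eq_add_of_le hi
  rw [show i + r + 1 = i + (r + 1) by ring, Finset.sum_range_add]
  rw [Finset.sum_eq_zero, zero_add, Nat.add_sub_cancel_left, ← Nat.sum_range_choose,
    Finset.sum_mul]
  · refine Finset.sum_congr rfl fun j hj => ?_
    simp at hj
    have := Nat.choose_mul (n := α + (i + r)) (k := α + (i + j)) (s := i + α) (by omega)
    rw [show i + j + α = α + (i + j) by ring, this, show i + r + α = α + (i + r) by ring,
      show α + (i + r) - (i + α) = r by omega, show α + (i + j) - (i + α) = j by omega]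
    ring
  · intro j hj
    simp at hj
    rw [Nat.choose_eq_zero_of_lt (by omega : j + α < i + α), mul_zero]

lemma lag_mult (α m : ℕ) (x : ℝ) :
    ∑ j ∈ Finset.range (m+1), ((2:ℝ)^m)⁻¹ * ((α + m).choose (α + j) : ℝ) * (lagP α j).eval (2 * x)
      = (lagP α m).eval x := by
  have h1 : ∀ j ∈ Finset.range (m+1),
      ((2:ℝ)^m)⁻¹ * ((α + m).choose (α + j) : ℝ) * (lagP α j).eval (2 * x) =
      ∑ i ∈ Finset.range (m+1), (((α + m).choose (α + j) * (j + α).choose (i + α) : ℕ) : ℝ) *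
        (((2:ℝ)^m)⁻¹ * ((-(2*x))^i / Nat.factorial i)) := by
    intro j hj
    simp at hj
    rw [lagP_eval α j (m+1) (by omega), Finset.mul_sum]
    refine Finset.sum_congr rfl fun i _ => ?_
    push_cast; ring
  rw [Finset.sum_congr rfl h1, Finset.sum_comm, lagP_eval α m (m+1) (by omega)]
  refine Finset.sum_congr rfl fun i hi => ?_
  simp at hi
  rw [← Finset.sum_mul, ← Nat.cast_sum, choose_sum α m i (by omega)]
  obtain ⟨r, rfl⟩ := Nat.exists_eq_add_of_le (by omega : i ≤ m)
  rw [Nat.add_sub_cancel_left, show -(2*x) = 2 * (-x) by ring, mul_pow, pow_add]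
  push_cast
  field_simp

lemma choose_rec (α m i : ℕ) :
    ((i:ℝ) + α + 1) * ((m+α).choose (i+1+α) : ℝ) + (2*i+α+1) * ((m+α).choose (i+α) : ℝ)
      + (if i = 0 then 0 else i * ((m+α).choose (i-1+α) : ℝ)) =
    (m+1) * ((m+1+α).choose (i+α) : ℝ) := by
  have e1 : ((i:ℝ) + α + 1) * ((m+α).choose (i+1+α) : ℝ) =
      ((m+α).choose (i+α) : ℝ) * (m - i) := by
    have := Nat.choose_succ_right_eq (m+α) (i+α)
    rw [show i+1+α = i+α+1 by ring]
    rcases le_or_gt i m with h | h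
    · have h2 : (((m+α).choose (i+α+1) * (i+α+1) : ℕ):ℝ)
        = ((m+α).choose (i+α) * (m+α-(i+α)) : ℕ) := by rw [this]
      rw [show m+α-(i+α) = m - i by omega] at h2
      push_cast [Nat.cast_sub h] at h2
      linarith
    · rw [Nat.choose_eq_zero_of_lt (by omega), Nat.choose_eq_zero_of_lt (by omega)]; simp
  rw [e1]
  cases i with
  | zero =>
    have h3 := Nat.choose_mul_succ_eq (m+α) α
    rw [show m+α+1-α = m+1 by omega] at h3
    have h4 : (((m+α).choose α * (m+α+1) : ℕ):ℝ) = ((m+α+1).choose α * (m+1) : ℕ) := by rw [h3]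
    push_cast at h4
    simp only [zero_add, if_true, show m+1+α = m+α+1 by ring]
    push_cast
    linarith
  | succ i =>
    simp only [Nat.add_sub_cancel, if_neg (Nat.succ_ne_zero i)]
    rw [show m+1+α = (m+α)+1 by ring, show i+1+α = (i+α)+1 by ring, Nat.choose_succ_succ]
    have e2 : ((m+α).choose (i+α+1) : ℝ) * (i+α+1) = ((m+α).choose (i+α) : ℝ) * (m - i) := by
      have := Nat.choose_succ_right_eq (m+α) (i+α)
      rcases le_or_gt i m with h | h
      · have h2 : (((m+α).choose (i+α+1) * (i+α+1) : ℕ):ℝ)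
          = ((m+α).choose (i+α) * (m+α-(i+α)) : ℕ) := by rw [this]
        rw [show m+α-(i+α) = m - i by omega] at h2
        push_cast [Nat.cast_sub h] at h2
        linarith
      · rw [Nat.choose_eq_zero_of_lt (by omega), Nat.choose_eq_zero_of_lt (by omega)]; simp
    push_cast [Nat.succ_eq_add_one]
    linear_combination e2

open Polynomial in
lemma lagP_rec (α m : ℕ) :
    X * (derivative (derivative (lagP α m)) - 2 * derivative (lagP α m) + lagP α m)
      + C ((α:ℝ) + 1) * (derivative (lagP α m) - lagP α m) = C (-((m:ℝ)+1)) * lagP α (m+1) := by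
  ext i
  have key := choose_rec α m i
  have hf : ∀ n : ℕ, (Nat.factorial n : ℝ) ≠ 0 := fun n => by positivity
  cases i with
  | zero =>
    simp only [coeff_add, coeff_X_mul_zero, coeff_C_mul, coeff_sub, coeff_derivative, lagP_coeff]
    simp at key ⊢
    linear_combination (-1) * key
  | succ i =>
    have h2 : (2 : ℝ[X]) = C 2 := rfl
    simp only [coeff_add, coeff_X_mul, h2, coeff_C_mul, coeff_sub, coeff_derivative, lagP_coeff]
    simp only [Nat.add_sub_cancel, if_neg (Nat.succ_ne_zero i)] at key
    push_cast [Nat.factorial_succ] at key ⊢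
    have := hf i
    have h3 : (i:ℝ) + 1 ≠ 0 := by positivity
    have h4 : (i:ℝ) + 1 + 1 ≠ 0 := by positivity
    field_simp
    simp only [pow_succ]
    linear_combination ((-1)^i : ℝ) * key

lemma iter2 (g g1 g2 : ℝ → ℝ) (h1 : ∀ x, HasDerivAt g (g1 x) x) (h2 : ∀ x, HasDerivAt g1 (g2 x) x)
    (c ε t : ℝ) : iteratedDeriv 2 (fun t => g (c + t^2/ε)) t =
      g2 (c + t^2/ε) * (2*t/ε)^2 + g1 (c + t^2/ε) * (2/ε) := by
  have hs : ∀ t : ℝ, HasDerivAt (fun t : ℝ => c + t^2/ε) (2*t/ε) t := by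
    intro t
    have := ((hasDerivAt_pow 2 t).div_const ε).const_add c
    simpa using this
  have hd : deriv (fun t => g (c + t^2/ε)) = fun t => g1 (c + t^2/ε) * (2*t/ε) := by
    funext t
    exact ((h1 _).comp t (hs t)).deriv
  rw [iteratedDeriv_succ, iteratedDeriv_one, hd]
  have h3 : HasDerivAt (fun t : ℝ => 2*t/ε) (2/ε) t := by
    have := ((hasDerivAt_id t).const_mul 2).div_const ε
    simpa using this
  have := (((h2 _).comp t (hs t)).mul h3).deriv
  simp only [Function.comp_def] at this
  refine Eq.trans this ?_
  ring

/-- squared norm over ε -/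
def sqE {d : ℕ} (ε : ℝ) (z : PS d) : ℝ := (∑ i, (z.1 i ^ 2 + z.2 i ^ 2)) / ε

lemma phaseLap_radial {d : ℕ} (ε : ℝ) (hε : 0 < ε) (g g1 g2 : ℝ → ℝ)
    (h1 : ∀ x, HasDerivAt g (g1 x) x) (h2 : ∀ x, HasDerivAt g1 (g2 x) x) :
    phaseLap (fun z : PS d => g (sqE ε z)) =
      fun z => (4/ε) * (sqE ε z * g2 (sqE ε z) + d * g1 (sqE ε z)) := by
  funext z
  unfold phaseLap
  have hA : ∀ i, iteratedDeriv 2 (fun t => g (sqE ε ((Function.update z.1 i t, z.2) : PS d))) (z.1 i)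
      = g2 (sqE ε z) * (2*z.1 i/ε)^2 + g1 (sqE ε z) * (2/ε) := by
    intro i
    have e : ∀ t, sqE ε ((Function.update z.1 i t, z.2) : PS d)
        = (sqE ε z - (z.1 i)^2/ε) + t^2/ε := by
      intro t
      unfold sqE
      rw [← sub_eq_iff_eq_add, ← sub_div, ← sub_div]
      congr 1
      rw [← Finset.add_sum_erase _ _ (Finset.mem_univ i),
        ← Finset.add_sum_erase _ (fun i => z.1 i ^ 2 + z.2 i ^ 2) (Finset.mem_univ i)]
      rw [Finset.sum_congr rfl (g := fun i => z.1 i ^ 2 + z.2 i ^ 2)]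
      · simp; ring
      · intro j hj
        simp [Function.update_of_ne (Finset.ne_of_mem_erase hj)]
    simp only [e]
    rw [iter2 g g1 g2 h1 h2]
    simp
  have hB : ∀ i, iteratedDeriv 2 (fun t => g (sqE ε ((z.1, Function.update z.2 i t) : PS d))) (z.2 i)
      = g2 (sqE ε z) * (2*z.2 i/ε)^2 + g1 (sqE ε z) * (2/ε) := by
    intro i
    have e : ∀ t, sqE ε ((z.1, Function.update z.2 i t) : PS d)
        = (sqE ε z - (z.2 i)^2/ε) + t^2/ε := by
      intro t
      unfold sqE
      rw [← sub_eq_iff_eq_add, ← sub_div, ← sub_div]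
      congr 1
      rw [← Finset.add_sum_erase _ _ (Finset.mem_univ i),
        ← Finset.add_sum_erase _ (fun i => z.1 i ^ 2 + z.2 i ^ 2) (Finset.mem_univ i)]
      rw [Finset.sum_congr rfl (g := fun i => z.1 i ^ 2 + z.2 i ^ 2)]
      · simp; ring
      · intro j hj
        simp [Function.update_of_ne (Finset.ne_of_mem_erase hj)]
    simp only [e]
    rw [iter2 g g1 g2 h1 h2]
    simp
  simp only [hA, hB]
  rw [← Finset.sum_add_distrib]
  have : ∀ i, (g2 (sqE ε z) * (2*z.1 i/ε)^2 + g1 (sqE ε z) * (2/ε)) +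
      (g2 (sqE ε z) * (2*z.2 i/ε)^2 + g1 (sqE ε z) * (2/ε)) =
      (z.1 i ^ 2 + z.2 i ^ 2) * (4 / ε^2 * g2 (sqE ε z)) + 4/ε * g1 (sqE ε z) := by
    intro i; field_simp; ring
  simp only [this]
  rw [Finset.sum_add_distrib, ← Finset.sum_mul]
  have hs : ∑ i, (z.1 i ^ 2 + z.2 i ^ 2) = ε * sqE ε z := by
    unfold sqE; field_simp
  rw [hs]
  simp
  field_simp

lemma deriv_expP (A : ℝ) (P : Polynomial ℝ) (x : ℝ) :
    HasDerivAt (fun x => A * Real.exp (-x) * P.eval x)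
      (A * Real.exp (-x) * (Polynomial.derivative P - P).eval x) x := by
  have h := (((hasDerivAt_neg x).exp).const_mul A).mul (P.hasDerivAt x)
  refine h.congr_deriv ?_
  simp
  ring

lemma phaseLap_iter (α : ℕ) (ε : ℝ) (hε : 0 < ε) (A : ℝ) (m : ℕ) :
    phaseLap^[m] (fun z : PS (α+1) => A * Real.exp (-(sqE ε z))) =
      fun z => A * (Nat.factorial m * (-4/ε)^m) * Real.exp (-(sqE ε z)) *
        (lagP α m).eval (sqE ε z) := by
  induction m with
  | zero =>
    funext z
    rw [lagP_eval α 0 1 (by omega)]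
    simp
  | succ m ih =>
    rw [Function.iterate_succ_apply', ih]
    set B := A * (Nat.factorial m * (-4/ε)^m)
    rw [phaseLap_radial ε hε (fun x => B * Real.exp (-x) * (lagP α m).eval x) _ _
      (deriv_expP B _) (deriv_expP B _)]
    funext z
    have h := congrArg (Polynomial.eval (sqE ε z)) (lagP_rec α m)
    simp at h ⊢
    simp only [B, Nat.factorial_succ]
    push_cast
    rw [pow_succ]
    linear_combination (4/ε) * (A * (Nat.factorial m * (-4/ε)^m)) * Real.exp (-(sqE ε z)) * h

lemma wigner_sum (α : ℕ) (ε : ℝ) (z : PS (α+1)) (j : ℕ) :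
    ∑ k ∈ Finset.Nat.antidiagonalTuple (α+1) j, wignerHermite ε k z =
      (-1)^j * ((((Real.pi * ε) ^ (α+1) : ℝ))⁻¹ * Real.exp (-(sqE ε z))
        * (lagP α j).eval (2 * sqE ε z)) := by
  have : 2 * sqE ε z = ∑ i, 2/ε * (z.1 i ^ 2 + z.2 i ^ 2) := by
    rw [← Finset.mul_sum]; unfold sqE; ring
  rw [this, ← lag_tuple, Finset.mul_sum, Finset.mul_sum]
  refine Finset.sum_congr rfl fun k hk => ?_
  rw [Finset.Nat.mem_antidiagonalTuple] at hk
  unfold wignerHermite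
  simp only [laguerre_eq, hk, sqE, neg_div]
  ring

lemma wigner_zero (d : ℕ) (ε : ℝ) :
    wignerHermite ε (fun _ : Fin d => 0) = fun z => (((Real.pi * ε) ^ d : ℝ))⁻¹ *
      Real.exp (-(sqE ε z)) := by
  funext z
  simp [wignerHermite, laguerre, sqE, neg_div]

/-- Pointwise kernel identity underlying the spectrogram expansion:
`Σ_{m<N} (1/m!)(−ε/4)^m Δ^m W_0 = Σ_{j<N} (−1)^j C_{N−1,j} Σ_{|k|=j} W_k`. -/
theorem spectrogram_kernel_identity
    (ε : ℝ) (hε : 0 < ε) (d : ℕ) (hd : 1 ≤ d) (N : ℕ) (hN : 1 ≤ N) (z : PS d) :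
    ∑ m ∈ Finset.range N,
        ((Nat.factorial m : ℝ))⁻¹ * (-ε / 4) ^ m *
          (phaseLap^[m] (wignerHermite ε (fun _ => 0))) z =
      ∑ j ∈ Finset.range N, (-1 : ℝ) ^ j * specCoeff d (N - 1) j *
        ∑ k ∈ Finset.Nat.antidiagonalTuple d j, wignerHermite ε k z := by
  obtain ⟨α, rfl⟩ : ∃ α, d = α + 1 := ⟨d - 1, by omega⟩
  obtain ⟨M, rfl⟩ : ∃ M, N = M + 1 := ⟨N - 1, by omega⟩
  simp only [wigner_sum, specCoeff, Nat.add_sub_cancel, wigner_zero, phaseLap_iter α ε hε]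
  simp only [Finset.mul_sum, Finset.sum_mul]
  rw [Finset.sum_comm' (t' := Finset.range (M+1)) (s' := fun m => Finset.range (m+1))]
  · refine Finset.sum_congr rfl fun m _ => ?_
    rw [← lag_mult α m (sqE ε z), Finset.mul_sum, Finset.mul_sum]
    refine Finset.sum_congr rfl fun j _ => ?_
    have h1 : (-ε/4)^m * (-4/ε)^m = 1 := by
      rw [← mul_pow]
      have : -ε/4 * (-4/ε) = 1 := by field_simp
      rw [this, one_pow]
    have h2 : ((-1:ℝ)^j) * (-1)^j = 1 := by rw [← mul_pow]; simp
    have h3 : ((Nat.factorial m : ℝ))⁻¹ * Nat.factorial m = 1 :=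
      inv_mul_cancel₀ (by positivity)
    generalize (Polynomial.eval (2 * sqE ε z) (lagP α j)) = L
    generalize ((Nat.factorial m : ℝ))⁻¹ = f at *
    generalize (-ε/4)^m = a at *
    generalize (-4/ε)^m = b at *
    generalize (-1:ℝ)^j = s at *
    generalize (((Real.pi * ε) ^ (α+1) : ℝ))⁻¹ = A
    generalize Real.exp (-(sqE ε z)) = E
    generalize ((2:ℝ)^m)⁻¹ * ((α + m).choose (α + j) : ℝ) = K
    linear_combination (K*L*A*E) * (f * Nat.factorial m * h1 + h3 - h2)
  · intro j m
    simp
    omega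
end
end

section
/- Gaussian smoothing cancellation to arbitrary order (symbol-level content of the Weyl–anti-Wick comparison lemma): Let d ≥ 1 and N ≥ 1. There exists a constant C ≥ 0, depending only on N and d, such that for every Schwartz function a : ℝ^{2d} → ℂ and every ε > 0, setting G_ε(z) = (πε)^{−d} e^{−|z|²/ε} and b_ε = Σ_{k=0}^{N−1} (1/k!) (−ε/4)^k Δ^k a, one has sup_{z ∈ ℝ^{2d}} | (G_ε * b_ε)(z) − a(z) | ≤ C ε^N · max_{|α| = 2N} sup_{z ∈ ℝ^{2d}} |∂^α a(z)|, where Δ is the Laplacian on ℝ^{2d}, * denotes convolution on ℝ^{2d}, and the maximum is over multi-indices α of order 2N. -/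
open MeasureTheory Finset

noncomputable section

/-- Partial derivative in the `i`-th coordinate of `ℝ^n`. -/
def pd {n : ℕ} (i : Fin n) (f : (Fin n → ℝ) → ℂ) : (Fin n → ℝ) → ℂ := fun z =>
  deriv (fun t => f (Function.update z i t)) (z i)

/-- The iterated partial derivative `∂^α` associated with a multi-index `α`. -/
def mpd {n : ℕ} (α : Fin n → ℕ) (f : (Fin n → ℝ) → ℂ) : (Fin n → ℝ) → ℂ :=
  (List.finRange n).foldr (fun i g => (pd i)^[α i] g) f

/-- The Laplacian on `ℝ^n`. -/
def lapN {n : ℕ} (f : (Fin n → ℝ) → ℂ) : (Fin n → ℝ) → ℂ := fun z =>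
  ∑ i, iteratedDeriv 2 (fun t => f (Function.update z i t)) (z i)

/-- The Gaussian `G_ε(z) = (πε)^{−d} e^{−|z|²/ε}` on `ℝ^{2d}`. -/
def gaussG (d : ℕ) (ε : ℝ) : (Fin (2 * d) → ℝ) → ℝ := fun z =>
  (((Real.pi * ε) ^ d : ℝ))⁻¹ * Real.exp (-(∑ i, z i ^ 2) / ε)

/-- The corrected symbol `b_ε = Σ_{k<N} (1/k!) (−ε/4)^k Δ^k a`. -/
def corrSymbol (d N : ℕ) (ε : ℝ) (a : (Fin (2 * d) → ℝ) → ℂ) :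
    (Fin (2 * d) → ℝ) → ℂ := fun y =>
  ∑ k ∈ Finset.range N,
    ((Nat.factorial k : ℂ))⁻¹ * (-(ε : ℂ) / 4) ^ k * (lapN^[k] a) y

open LineDeriv SchwartzMap in
/-- Schwartz-space partial derivative. -/
def dS {n : ℕ} (i : Fin n) (f : SchwartzMap (Fin n → ℝ) ℂ) : SchwartzMap (Fin n → ℝ) ℂ :=
  ∂_{(Pi.single i 1 : Fin n → ℝ)} f

/-- Schwartz-space Laplacian. -/
def lapS {n : ℕ} (f : SchwartzMap (Fin n → ℝ) ℂ) : SchwartzMap (Fin n → ℝ) ℂ :=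
  ∑ i, dS i (dS i f)

theorem dS_apply {n : ℕ} (i : Fin n) (f : SchwartzMap (Fin n → ℝ) ℂ) (x : Fin n → ℝ) :
    dS i f x = fderiv ℝ f x (Pi.single i 1) := rfl

theorem hasDerivAt_upd {n : ℕ} (i : Fin n) (f : SchwartzMap (Fin n → ℝ) ℂ) (z : Fin n → ℝ)
    (t : ℝ) : HasDerivAt (fun t => f (Function.update z i t)) (dS i f (Function.update z i t)) t := by
  have h1 : HasFDerivAt f (fderiv ℝ f (Function.update z i t)) (Function.update z i t) :=
    f.differentiableAt.hasFDerivAt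
  exact h1.comp_hasDerivAt t (hasDerivAt_update z i t)

theorem pd_eq {n : ℕ} (i : Fin n) (f : SchwartzMap (Fin n → ℝ) ℂ) : pd i (⇑f) = ⇑(dS i f) := by
  funext z
  simp only [pd]
  rw [(hasDerivAt_upd i f z (z i)).deriv, Function.update_eq_self]

theorem lapN_eq {n : ℕ} (f : SchwartzMap (Fin n → ℝ) ℂ) : lapN (⇑f) = ⇑(lapS f) := by
  funext z
  simp only [lapN, lapS, _root_.sum_apply]
  refine Finset.sum_congr rfl fun i _ => ?_
  have h : deriv (fun t => f (Function.update z i t)) = fun t => dS i f (Function.update z i t) :=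
    funext fun t => (hasDerivAt_upd i f z t).deriv
  rw [iteratedDeriv_succ, iteratedDeriv_one, h, (hasDerivAt_upd i (dS i f) z (z i)).deriv,
    Function.update_eq_self]

theorem lapN_iter {n : ℕ} (k : ℕ) (f : SchwartzMap (Fin n → ℝ) ℂ) :
    lapN^[k] (⇑f) = ⇑(lapS^[k] f) := by
  induction k generalizing f with
  | zero => rfl
  | succ k ih => rw [Function.iterate_succ_apply, Function.iterate_succ_apply, lapN_eq, ih]

theorem pd_iter {n : ℕ} (i : Fin n) (k : ℕ) (f : SchwartzMap (Fin n → ℝ) ℂ) :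
    (pd i)^[k] (⇑f) = ⇑((List.replicate k i).foldr dS f) := by
  induction k with
  | zero => rfl
  | succ k ih => rw [Function.iterate_succ_apply', ih, pd_eq, List.replicate_succ, List.foldr_cons]

theorem mpd_eq_aux {n : ℕ} (α : Fin n → ℕ) (l : List (Fin n)) (f : SchwartzMap (Fin n → ℝ) ℂ) :
    l.foldr (fun i g => (pd i)^[α i] g) (⇑f)
      = ⇑((l.flatMap fun i => List.replicate (α i) i).foldr dS f) := by
  induction l with
  | nil => rfl
  | cons i l ih =>
    rw [List.foldr_cons, ih, List.flatMap_cons, List.foldr_append, pd_iter]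

theorem mpd_eq {n : ℕ} (α : Fin n → ℕ) (f : SchwartzMap (Fin n → ℝ) ℂ) :
    mpd α (⇑f) = ⇑(((List.finRange n).flatMap fun i => List.replicate (α i) i).foldr dS f) :=
  mpd_eq_aux α _ f

theorem dS_comm {n : ℕ} (i j : Fin n) (f : SchwartzMap (Fin n → ℝ) ℂ) :
    dS i (dS j f) = dS j (dS i f) := by
  have key : ∀ (i j : Fin n) (x : Fin n → ℝ), dS i (dS j f) x
      = fderiv ℝ (fderiv ℝ f) x (Pi.single i 1) (Pi.single j 1) := by
    intro i j x
    rw [dS_apply]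
    have h : HasFDerivAt (fderiv ℝ f) (fderiv ℝ (fderiv ℝ f) x) x := by
      have : ContDiff ℝ 1 (fderiv ℝ f) := (f.smooth 2).fderiv_right (by norm_num)
      exact (this.differentiable (by norm_num) x).hasFDerivAt
    have h2 := h.clm_apply (hasFDerivAt_const (Pi.single j 1 : Fin n → ℝ) x)
    have h3 : (⇑(dS j f)) = fun y => fderiv ℝ f y (Pi.single j 1) := rfl
    rw [h3, h2.fderiv]
    simp
  ext x
  rw [key, key]
  have : IsSymmSndFDerivAt ℝ f x := by
    apply ContDiffAt.isSymmSndFDerivAt (n := 2) (f.smooth 2).contDiffAt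
    simp
  exact this _ _

theorem foldr_dS_eq {n : ℕ} (l : List (Fin n)) (f : SchwartzMap (Fin n → ℝ) ℂ) :
    ⇑(l.foldr dS f) = mpd (fun i => l.count i) (⇑f) := by
  rw [mpd_eq]
  congr 1
  refine List.Perm.foldr_eq' ?_ (fun x _ y _ z => dS_comm y x z) f
  rw [List.perm_iff_count]
  intro a
  rw [List.count_flatMap]
  have : (List.count a ∘ fun i => List.replicate (List.count i l) i)
      = fun i => if i = a then List.count a l else 0 := by
    funext i
    simp only [Function.comp, List.count_replicate]
    by_cases h : i = a
    · subst h; simp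
    · simp [h]
  rw [this, ← Fin.sum_univ_def]
  simp

theorem dS_sum {n : ℕ} {ι : Type*} (s : Finset ι) (i : Fin n) (f : ι → SchwartzMap (Fin n → ℝ) ℂ) :
    dS i (∑ j ∈ s, f j) = ∑ j ∈ s, dS i (f j) := by
  unfold dS
  exact LineDeriv.lineDerivOp_sum _ _ _

theorem foldr_dS_sum {n : ℕ} {ι : Type*} (s : Finset ι) (l : List (Fin n))
    (f : ι → SchwartzMap (Fin n → ℝ) ℂ) :
    l.foldr dS (∑ j ∈ s, f j) = ∑ j ∈ s, l.foldr dS (f j) := by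
  induction l with
  | nil => rfl
  | cons i l ih => simp only [List.foldr_cons, ih, dS_sum]

theorem lap_bound {n : ℕ} (N : ℕ) (f : SchwartzMap (Fin n → ℝ) ℂ) (M : ℝ)
    (h : ∀ l : List (Fin n), l.length = 2 * N → ∀ w, ‖l.foldr dS f w‖ ≤ M) (w : Fin n → ℝ) :
    ‖lapS^[N] f w‖ ≤ (n : ℝ) ^ N * M := by
  induction N generalizing f M with
  | zero => simpa using h [] (by simp) w
  | succ N ih =>
    rw [Function.iterate_succ_apply, pow_succ, mul_assoc]
    apply ih
    intro l hl w
    rw [lapS, foldr_dS_sum, _root_.sum_apply]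
    refine (norm_sum_le _ _).trans ?_
    refine (Finset.sum_le_card_nsmul _ _ M fun i _ => ?_).trans (by simp)
    have := h (l ++ [i, i]) (by simp [hl]; ring) w
    simpa [List.foldr_append] using this

theorem schwartz_bdd {n : ℕ} (f : SchwartzMap (Fin n → ℝ) ℂ) : ∃ C, ∀ x, ‖f x‖ ≤ C := by
  obtain ⟨C, hC⟩ := f.decay 0 0
  exact ⟨C, fun x => by simpa using hC.2 x⟩

theorem lap_bound_sup {n : ℕ} (N : ℕ) (f : SchwartzMap (Fin n → ℝ) ℂ) (w : Fin n → ℝ) :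
    ‖lapS^[N] f w‖ ≤ (n : ℝ) ^ N *
      ⨆ α : {α : Fin n → ℕ // ∑ i, α i = 2 * N}, ⨆ w : Fin n → ℝ, ‖mpd α.1 (⇑f) w‖ := by
  apply lap_bound
  intro l hl w
  have hfin : Finite {α : Fin n → ℕ // ∑ i, α i = 2 * N} := by
    apply Finite.of_injective (β := Fin n → Fin (2 * N + 1))
      (fun α i => ⟨α.1 i, by
        have := Finset.single_le_sum (f := α.1) (fun i _ => Nat.zero_le _) (Finset.mem_univ i)
        have h2 := α.2
        omega⟩)
    intro α β h
    ext i
    have := congrFun h i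
    simpa using this
  have hl2 : ∑ i, l.count i = 2 * N := by
    rw [← hl]
    have := Multiset.sum_count_eq_card (s := Finset.univ) (m := (l : Multiset (Fin n)))
      (fun a _ => Finset.mem_univ a)
    simpa using this
  rw [foldr_dS_eq]
  refine le_trans ?_ (le_ciSup (Set.finite_range _).bddAbove ⟨fun i => l.count i, hl2⟩)
  refine le_ciSup (f := fun w => ‖mpd (fun i => l.count i) (⇑f) w‖) ?_ w
  rw [← foldr_dS_eq]
  obtain ⟨C, hC⟩ := schwartz_bdd (l.foldr dS f)
  exact ⟨C, by rintro _ ⟨x, rfl⟩; exact hC x⟩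

/-- Unnormalized Gaussian. -/
def ph {n : ℕ} (x : Fin n → ℝ) : ℝ := Real.exp (-∑ i, x i ^ 2)

theorem ph_cont {n : ℕ} : Continuous (ph (n := n)) := by
  unfold ph; fun_prop

theorem ph_pos {n : ℕ} (x : Fin n → ℝ) : 0 < ph x := Real.exp_pos _

theorem ph_prod {n : ℕ} (x : Fin n → ℝ) : ph x = ∏ i, Real.exp (-1 * x i ^ 2) := by
  rw [ph, ← Real.exp_sum, ← Finset.mul_sum]; ring_nf

theorem ph_int {n : ℕ} : Integrable (ph (n := n)) := by
  have : (ph (n := n)) = fun x => ∏ i, (fun t : ℝ => Real.exp (-1 * t ^ 2)) (x i) :=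
    funext ph_prod
  rw [this]
  exact Integrable.fintype_prod (f := fun _ : Fin n => fun t : ℝ => Real.exp (-1 * t ^ 2))
    (fun i => integrable_exp_neg_mul_sq one_pos)

theorem ph_integral {d : ℕ} : ∫ x : Fin (2 * d) → ℝ, ph x = Real.pi ^ d := by
  simp_rw [ph_prod]
  rw [integral_fintype_prod_volume_eq_pow (fun t : ℝ => Real.exp (-1 * t ^ 2)), integral_gaussian]
  simp [pow_mul, Real.sq_sqrt Real.pi_pos.le]

theorem ph_mul_int {n : ℕ} (i : Fin n) : Integrable (fun x : Fin n → ℝ => x i * ph x) := by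
  have : (fun x : Fin n → ℝ => x i * ph x) =
      fun x => ∏ j, (fun t : ℝ => (if j = i then t else 1) * Real.exp (-1 * t ^ 2)) (x j) := by
    funext x
    simp only [Finset.prod_mul_distrib, ph_prod]
    simp
  rw [this]
  refine Integrable.fintype_prod
    (f := fun j : Fin n => fun t : ℝ => (if j = i then t else 1) * Real.exp (-1 * t ^ 2))
    (fun j => ?_)
  by_cases h : j = i
  · simpa [h] using integrable_mul_exp_neg_mul_sq one_pos
  · simpa [h] using integrable_exp_neg_mul_sq one_pos

theorem int_mul_bdd {n : ℕ} {p : (Fin n → ℝ) → ℝ} (hp : Integrable p)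
    (g : SchwartzMap (Fin n → ℝ) ℂ) (z : Fin n → ℝ) (r : ℝ) :
    Integrable (fun x => (p x : ℂ) * g (z - r • x)) := by
  obtain ⟨C, hC⟩ := schwartz_bdd g
  refine hp.ofReal.mul_bdd (c := C) ?_ (ae_of_all _ fun x => hC _)
  exact (g.continuous.comp (by fun_prop)).aestronglyMeasurable

/-- Gaussian average. -/
def J {n : ℕ} (z : Fin n → ℝ) (g : SchwartzMap (Fin n → ℝ) ℂ) (r : ℝ) : ℂ :=
  ∫ x, (ph x : ℂ) * g (z - r • x)

theorem ph_line {n : ℕ} (i : Fin n) (x : Fin n → ℝ) :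
    HasLineDerivAt ℝ (fun x => (ph x : ℂ)) (((-2) * (x i * ph x) : ℝ) : ℂ) x (Pi.single i 1) := by
  unfold HasLineDerivAt
  apply HasDerivAt.ofReal_comp
  have h1 : HasDerivAt (fun t : ℝ => ∑ j, (x + t • (Pi.single i 1 : Fin n → ℝ)) j ^ 2)
      (∑ j, 2 * x j * (Pi.single i 1 : Fin n → ℝ) j) 0 := by
    apply HasDerivAt.fun_sum
    intro j _
    have h := (((hasDerivAt_id (0:ℝ)).mul_const ((Pi.single i 1 : Fin n → ℝ) j)).const_add (x j)).fun_pow 2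
    simpa using h
  have h2 := h1.neg.exp
  refine h2.congr_deriv ?_
  have e1 : ∑ j, 2 * x j * (Pi.single i 1 : Fin n → ℝ) j = 2 * x i := by
    simp [Pi.single_apply]
  have e2 : (-fun t : ℝ => ∑ j, (x + t • (Pi.single i 1 : Fin n → ℝ)) j ^ 2) 0
      = -∑ j, x j ^ 2 := by simp
  rw [e1, e2, ph]
  ring

theorem sch_line {n : ℕ} (i : Fin n) (g : SchwartzMap (Fin n → ℝ) ℂ) (z x : Fin n → ℝ) (r : ℝ) :
    HasLineDerivAt ℝ (fun x => g (z - r • x)) (-(r : ℂ) * dS i g (z - r • x)) x (Pi.single i 1) := by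
  unfold HasLineDerivAt
  have h1 : HasDerivAt (fun t : ℝ => z - r • (x + t • (Pi.single i 1 : Fin n → ℝ)))
      (-(r • (Pi.single i 1 : Fin n → ℝ))) 0 := by
    have h := ((((hasDerivAt_id (0:ℝ)).smul_const (Pi.single i 1 : Fin n → ℝ)).const_add x).const_smul
      r).const_sub z
    simpa using h
  have h0 : z - r • x = z - r • (x + (0 : ℝ) • (Pi.single i 1 : Fin n → ℝ)) := by simp
  have hf : HasFDerivAt g (fderiv ℝ g (z - r • x))
      (z - r • (x + (0 : ℝ) • (Pi.single i 1 : Fin n → ℝ))) := by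
    rw [← h0]; exact g.differentiableAt.hasFDerivAt
  have := hf.comp_hasDerivAt (0 : ℝ) h1
  refine this.congr_deriv ?_
  rw [dS_apply, map_neg, map_smul, neg_mul]
  simp

theorem ibp {n : ℕ} (i : Fin n) (g : SchwartzMap (Fin n → ℝ) ℂ) (z : Fin n → ℝ) (r : ℝ) :
    ∫ x, ((x i * ph x : ℝ) : ℂ) * g (z - r • x) = -(r : ℂ) / 2 * J z (dS i g) r := by
  have h := integral_bilinear_hasLineDerivAt_right_eq_neg_left_of_integrable
    (μ := (volume : Measure (Fin n → ℝ)))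
    (f := fun x => (ph x : ℂ)) (f' := fun x => (((-2) * (x i * ph x) : ℝ) : ℂ))
    (g := fun x => g (z - r • x)) (g' := fun x => (-(r : ℂ) * dS i g (z - r • x)))
    (v := Pi.single i 1) (B := ContinuousLinearMap.mul ℝ ℂ)
    (by simpa using int_mul_bdd ((ph_mul_int i).const_mul (-2)) g z r)
    (by
      have := (int_mul_bdd ph_int (dS i g) z r).const_mul (-(r:ℂ))
      refine this.congr (ae_of_all _ fun x => ?_)
      simp only [ContinuousLinearMap.mul_apply']
      ring)
    (by simpa using int_mul_bdd ph_int g z r)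
    (fun x _ => ph_line i x) (fun x _ => sch_line i g z x r)
  simp only [ContinuousLinearMap.mul_apply'] at h
  have e1 : ∫ x, (ph x : ℂ) * (-(r : ℂ) * dS i g (z - r • x)) = -(r : ℂ) * J z (dS i g) r := by
    rw [J, ← integral_const_mul]
    congr 1; funext x; ring
  have e2 : ∫ x : Fin n → ℝ, (((-2) * (x i * ph x) : ℝ) : ℂ) * g (z - r • x)
      = -2 * ∫ x, ((x i * ph x : ℝ) : ℂ) * g (z - r • x) := by
    rw [← integral_const_mul]
    congr 1; funext x; push_cast; ring
  rw [e1, e2] at h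
  linear_combination (-1/2 : ℂ) * h

theorem fderiv_eq_sum {n : ℕ} (g : SchwartzMap (Fin n → ℝ) ℂ) (p x : Fin n → ℝ) :
    fderiv ℝ g p x = ∑ i, (x i : ℂ) * dS i g p := by
  conv_lhs => rw [pi_eq_sum_univ' x]
  rw [map_sum]
  refine Finset.sum_congr rfl fun i _ => ?_
  rw [map_smul, dS_apply]
  simp

theorem J_deriv {n : ℕ} (g : SchwartzMap (Fin n → ℝ) ℂ) (z : Fin n → ℝ) (r : ℝ) :
    HasDerivAt (J z g) ((r : ℂ) / 2 * J z (lapS g) r) r := by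
  choose C hC using fun i => schwartz_bdd (dS i g)
  have hint : ∀ i, Integrable (fun x : Fin n → ℝ => ((x i * ph x : ℝ) : ℂ) * dS i g (z - r • x)) :=
    fun i => int_mul_bdd (ph_mul_int i) (dS i g) z r
  have h := hasDerivAt_integral_of_dominated_loc_of_deriv_le
    (μ := (volume : Measure (Fin n → ℝ))) (x₀ := r) (s := Set.univ)
    (F := fun r x => (ph x : ℂ) * g (z - r • x))
    (F' := fun r x => -∑ i, ((x i * ph x : ℝ) : ℂ) * dS i g (z - r • x))
    (bound := fun x => ∑ i, ‖x i * ph x‖ * C i)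
    Filter.univ_mem
    (Filter.Eventually.of_forall fun r => (int_mul_bdd ph_int g z r).aestronglyMeasurable)
    (int_mul_bdd ph_int g z r)
    (integrable_finsetSum _ fun i _ => hint i).neg.aestronglyMeasurable
    (ae_of_all _ fun x r _ => by
      rw [norm_neg]
      refine (norm_sum_le _ _).trans (Finset.sum_le_sum fun i _ => ?_)
      rw [norm_mul, Complex.norm_real]
      exact mul_le_mul_of_nonneg_left (hC i _) (norm_nonneg _))
    (integrable_finsetSum _ fun i _ => (ph_mul_int i).norm.mul_const _)
    (ae_of_all _ fun x r _ => by
      have h1 : HasDerivAt (fun t : ℝ => z - t • x) (-x) r := by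
        simpa using ((hasDerivAt_id r).smul_const x).const_sub z
      have hf : HasFDerivAt g (fderiv ℝ g (z - r • x)) (z - r • x) :=
        g.differentiableAt.hasFDerivAt
      have := (hf.comp_hasDerivAt r h1).const_mul (ph x : ℂ)
      refine this.congr_deriv ?_
      rw [map_neg, fderiv_eq_sum, mul_neg, Finset.mul_sum]
      congr 1
      refine Finset.sum_congr rfl fun i _ => ?_
      push_cast; ring)
  have h2 := h.2
  have e : ∫ x : Fin n → ℝ, -∑ i, ((x i * ph x : ℝ) : ℂ) * dS i g (z - r • x)
      = (r : ℂ) / 2 * J z (lapS g) r := by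
    rw [integral_neg, integral_finsetSum _ fun i _ => hint i]
    simp_rw [ibp]
    have : J z (lapS g) r = ∑ i, J z (dS i (dS i g)) r := by
      unfold J
      rw [← integral_finsetSum _ fun i _ => int_mul_bdd ph_int _ z r]
      simp only [lapS, _root_.sum_apply, Finset.mul_sum]
    rw [this, ← Finset.mul_sum]
    ring
  rw [e] at h2
  exact h2

/-- Taylor coefficient. -/
def cf (k : ℕ) (r : ℝ) : ℂ := ((Nat.factorial k : ℂ))⁻¹ * (-((r ^ 2 : ℝ) : ℂ) / 4) ^ k

theorem cf_deriv (k : ℕ) (r : ℝ) : HasDerivAt (cf (k + 1)) (-(r : ℂ) / 2 * cf k r) r := by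
  have h1 : HasDerivAt (fun r : ℝ => ((r ^ 2 : ℝ) : ℂ)) ((2 * r : ℝ) : ℂ) r := by
    apply HasDerivAt.ofReal_comp
    simpa using hasDerivAt_pow 2 r
  have h2 := ((h1.neg.div_const 4).pow (k + 1)).const_mul (((k + 1).factorial : ℂ))⁻¹
  refine h2.congr_deriv ?_
  unfold cf
  have : ((k : ℂ) + 1) ≠ 0 := by exact_mod_cast Nat.succ_ne_zero k
  have h3 : (k.factorial : ℂ) ≠ 0 := by exact_mod_cast Nat.factorial_ne_zero k
  rw [Nat.factorial_succ]
  push_cast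
  simp only [Nat.add_sub_cancel, Pi.neg_apply]
  push_cast
  field_simp
  try ring

theorem F_deriv {n : ℕ} (a : SchwartzMap (Fin n → ℝ) ℂ) (z : Fin n → ℝ) (m : ℕ) (r : ℝ) :
    HasDerivAt (fun r => ∑ k ∈ Finset.range (m + 1), cf k r * J z (lapS^[k] a) r)
      ((r : ℂ) / 2 * cf m r * J z (lapS^[m + 1] a) r) r := by
  induction m with
  | zero =>
    simpa [cf] using J_deriv a z r
  | succ m ih =>
    simp_rw [Finset.sum_range_succ _ (m + 1)]
    have h := ih.add ((cf_deriv m r).mul (J_deriv (lapS^[m + 1] a) z r))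
    refine h.congr_deriv ?_
    rw [Function.iterate_succ_apply' lapS (m + 1)]
    ring

theorem J_bound {d : ℕ} (g : SchwartzMap (Fin (2 * d) → ℝ) ℂ) (z : Fin (2 * d) → ℝ) (r M : ℝ)
    (hM : ∀ w, ‖g w‖ ≤ M) : ‖J z g r‖ ≤ Real.pi ^ d * M := by
  rw [← ph_integral, ← integral_mul_const]
  refine norm_integral_le_of_norm_le (ph_int.mul_const M) (ae_of_all _ fun x => ?_)
  rw [norm_mul, Complex.norm_real, Real.norm_of_nonneg (ph_pos x).le]
  exact mul_le_mul_of_nonneg_left (hM _) (ph_pos x).le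

theorem cf_bound (k : ℕ) (r : ℝ) : ‖cf k r‖ ≤ (r ^ 2) ^ k := by
  rw [cf, norm_mul, norm_inv, norm_pow, norm_div, norm_neg, Complex.norm_real, Complex.norm_natCast,
    Real.norm_of_nonneg (sq_nonneg r)]
  have h1 : ((k.factorial : ℝ))⁻¹ ≤ 1 := inv_le_one_of_one_le₀ (by exact_mod_cast k.factorial_pos)
  have h2 : (r ^ 2 / ‖(4 : ℂ)‖) ^ k ≤ (r ^ 2) ^ k := by
    apply pow_le_pow_left₀ (by positivity)
    have : ‖(4 : ℂ)‖ = 4 := by simp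
    rw [this]
    nlinarith [sq_nonneg r]
  calc _ ≤ 1 * (r ^ 2) ^ k := mul_le_mul h1 h2 (by positivity) zero_le_one
    _ = _ := one_mul _

theorem J_zero {d : ℕ} (g : SchwartzMap (Fin (2 * d) → ℝ) ℂ) (z : Fin (2 * d) → ℝ) :
    J z g 0 = (Real.pi : ℂ) ^ d * g z := by
  simp only [J, zero_smul, sub_zero]
  rw [integral_mul_const, integral_complex_ofReal, ph_integral]
  push_cast; rfl

theorem conv_eq {d : ℕ} (N : ℕ) (a : SchwartzMap (Fin (2 * d) → ℝ) ℂ) (z : Fin (2 * d) → ℝ)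
    (r : ℝ) (hr : 0 < r) :
    ∫ w : Fin (2 * d) → ℝ, ((gaussG d (r ^ 2) w : ℝ) : ℂ) * corrSymbol d N (r ^ 2) (⇑a) (z - w)
      = ((Real.pi : ℂ) ^ d)⁻¹ * ∑ k ∈ Finset.range N, cf k r * J z (lapS^[k] a) r := by
  have h := Measure.integral_comp_smul_of_nonneg (volume : Measure (Fin (2 * d) → ℝ))
    (fun w => ((gaussG d (r ^ 2) w : ℝ) : ℂ) * corrSymbol d N (r ^ 2) (⇑a) (z - w)) r (hR := hr.le)
  have hr0 : (r : ℂ) ≠ 0 := by exact_mod_cast hr.ne'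
  have hpi : (Real.pi : ℂ) ≠ 0 := by exact_mod_cast Real.pi_pos.ne'
  have hG : ∀ x : Fin (2 * d) → ℝ, gaussG d (r ^ 2) (r • x)
      = ((Real.pi * r ^ 2) ^ d)⁻¹ * ph x := by
    intro x
    rw [gaussG, ph]
    congr 2
    simp only [Pi.smul_apply, smul_eq_mul, mul_pow, ← Finset.mul_sum]
    field_simp
  have e : ∫ x : Fin (2 * d) → ℝ, ((gaussG d (r ^ 2) (r • x) : ℝ) : ℂ) *
      corrSymbol d N (r ^ 2) (⇑a) (z - r • x)
      = (((Real.pi : ℂ) * r ^ 2) ^ d)⁻¹ * ∑ k ∈ Finset.range N, cf k r * J z (lapS^[k] a) r := by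
    simp only [J, ← integral_const_mul]
    rw [← integral_finsetSum _ fun k _ => (int_mul_bdd ph_int _ z r).const_mul _,
      ← integral_const_mul]
    congr 1
    funext x
    rw [hG, corrSymbol, Finset.mul_sum, Finset.mul_sum]
    refine Finset.sum_congr rfl fun k _ => ?_
    rw [lapN_iter, cf]
    push_cast
    ring
  rw [e] at h
  simp only [Module.finrank_fin_fun, Complex.real_smul] at h
  push_cast at h
  have hp : (r : ℂ) ^ (2 * d) ≠ 0 := pow_ne_zero _ hr0
  have h' := congrArg (fun t => (r : ℂ) ^ (2 * d) * t) h
  simp only [mul_inv_cancel_left₀ hp] at h'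
  push_cast
  rw [← h', mul_pow, ← pow_mul]
  field_simp

/-- Gaussian smoothing cancellation to arbitrary order: there is `C ≥ 0`, depending only
on `N` and `d`, with `sup_z |(G_ε * b_ε)(z) − a(z)| ≤ C ε^N max_{|α|=2N} sup |∂^α a|`
for every Schwartz `a` and every `ε > 0`. -/
theorem gaussian_smoothing_cancellation (d N : ℕ) (hd : 1 ≤ d) (hN : 1 ≤ N) :
    ∃ C : ℝ, 0 ≤ C ∧
      ∀ (a : SchwartzMap (Fin (2 * d) → ℝ) ℂ) (ε : ℝ), 0 < ε →
        ∀ z : Fin (2 * d) → ℝ,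
          ‖(∫ w : Fin (2 * d) → ℝ,
              ((gaussG d ε w : ℝ) : ℂ) * corrSymbol d N ε (⇑a) (z - w)) - a z‖ ≤
            C * ε ^ N *
              ⨆ α : {α : Fin (2 * d) → ℕ // ∑ i, α i = 2 * N},
                ⨆ w : Fin (2 * d) → ℝ, ‖mpd α.1 (⇑a) w‖ := by
  refine ⟨((2 * d : ℕ) : ℝ) ^ N, by positivity, ?_⟩
  intro a ε hε z
  obtain ⟨m, rfl⟩ : ∃ m, N = m + 1 := ⟨N - 1, by omega⟩
  obtain ⟨r, hr, rfl⟩ : ∃ r : ℝ, 0 < r ∧ ε = r ^ 2 :=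
    ⟨√ε, Real.sqrt_pos.2 hε, (Real.sq_sqrt hε.le).symm⟩
  set S := ⨆ α : {α : Fin (2 * d) → ℕ // ∑ i, α i = 2 * (m + 1)},
    ⨆ w : Fin (2 * d) → ℝ, ‖mpd α.1 (⇑a) w‖ with hS
  have hS0 : 0 ≤ S := Real.iSup_nonneg fun α => Real.iSup_nonneg fun w => norm_nonneg _
  rw [conv_eq _ _ _ _ hr]
  set F : ℝ → ℂ := fun r => ∑ k ∈ Finset.range (m + 1), cf k r * J z (lapS^[k] a) r with hF
  have hF0 : F 0 = (Real.pi : ℂ) ^ d * a z := by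
    rw [hF]
    simp only
    rw [Finset.sum_range_succ']
    simp [cf, J_zero]
  have hpi : ((Real.pi : ℂ) ^ d) ≠ 0 := pow_ne_zero _ (by exact_mod_cast Real.pi_pos.ne')
  have hbound := (convex_Icc (0 : ℝ) r).norm_image_sub_le_of_norm_hasDerivWithin_le
    (f := F) (C := r * (r ^ 2) ^ m * (Real.pi ^ d * (((2 * d : ℕ) : ℝ) ^ (m + 1) * S)))
    (fun t _ => (F_deriv a z m t).hasDerivWithinAt)
    (by
      intro t ht
      rw [norm_mul, norm_mul]
      have h1 : ‖(t : ℂ) / 2‖ ≤ r := by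
        rw [norm_div, Complex.norm_real, Real.norm_of_nonneg ht.1]
        have : ‖(2 : ℂ)‖ = 2 := by simp
        rw [this]
        linarith [ht.1, ht.2]
      have h2 : ‖cf m t‖ ≤ (r ^ 2) ^ m :=
        (cf_bound m t).trans (pow_le_pow_left₀ (by positivity)
          (pow_le_pow_left₀ ht.1 ht.2 2) m)
      have h3 := J_bound (lapS^[m + 1] a) z t _ (fun w => lap_bound_sup (m + 1) a w)
      exact mul_le_mul (mul_le_mul h1 h2 (norm_nonneg _) hr.le) h3 (norm_nonneg _) (by positivity))
    (Set.left_mem_Icc.2 hr.le) (Set.right_mem_Icc.2 hr.le)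
  rw [hF0, sub_zero, Real.norm_of_nonneg hr.le] at hbound
  have e : ((Real.pi : ℂ) ^ d)⁻¹ * F r - a z
      = ((Real.pi : ℂ) ^ d)⁻¹ * (F r - (Real.pi : ℂ) ^ d * a z) := by
    field_simp
  change ‖((Real.pi : ℂ) ^ d)⁻¹ * F r - a z‖ ≤ _
  rw [e, norm_mul, norm_inv, norm_pow, Complex.norm_real, Real.norm_of_nonneg Real.pi_pos.le]
  have hp : 0 < Real.pi ^ d := pow_pos Real.pi_pos d
  refine (mul_le_mul_of_nonneg_left hbound (inv_nonneg.2 hp.le)).trans (le_of_eq ?_)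
  field_simp
  ring
end
end
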